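/- arXiv:1302.7069 — 5 statements merged into one kernel-verified Lean document; each statement's English description precedes it below -/
import Mathlib

section
/- Let H_x = {x+n : n ≤ card(W_x)} (so H_x = {x+n : n ∈ ℕ} when W_x is infinite) and L_x = {x+n : n ∈ ℕ}. The family F = {H_x : x ∈ ℕ} ∪ {L_x : x ∈ ℕ} is a u.c.e. family and is TxtBC-learnable by some computable learner. -/
/-- `Wset e` is the `e`-th computably enumerable set: the domain of the `e`-th
partial computable function in the standard numbering by codes. -/
def Wset (e : ℕ) : Set ℕ :=
  {x | ((Denumerable.ofNat Nat.Partrec.Code e).eval x).Dom}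

/-- The `i`-th column `{x : ⟨i,x⟩ ∈ W_a}` of the c.e. set coded by `a`;
the number `a` codes the u.c.e. family whose members are its columns. -/
def column (a i : ℕ) : Set ℕ := {x | Nat.pair i x ∈ Wset a}

/-- The initial segment of length `n` of an enumeration `f`. -/
def initSeg (f : ℕ → ℕ) (n : ℕ) : List ℕ := (List.range n).map f

/-- The `m`-th computable learner in the standard effective enumeration of all
partial computable functions from finite sequences to ℕ. -/
def learnerOfCode (m : ℕ) : List ℕ →. ℕ :=
  fun σ => (Denumerable.ofNat Nat.Partrec.Code m).eval (Encodable.encode σ)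

/-- `M` TxtFin-identifies the enumeration `f` (here `Option.none` plays the
role of the symbol `?`). -/
def TxtFinIdentifies (M : List ℕ →. Option ℕ) (f : ℕ → ℕ) : Prop :=
  ∃ n h, (∀ n' < n, M (initSeg f n') = Part.some Option.none) ∧
    M (initSeg f n) = Part.some (Option.some h) ∧ Wset h = Set.range f

/-- `M` TxtFin-learns the set `S`. -/
def TxtFinLearnsSet (M : List ℕ →. Option ℕ) (S : Set ℕ) : Prop :=
  ∀ f : ℕ → ℕ, Set.range f = S → TxtFinIdentifies M f

/-- `M` TxtEx-identifies the enumeration `f`. -/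
def TxtExIdentifies (M : List ℕ →. ℕ) (f : ℕ → ℕ) : Prop :=
  ∃ n, (∃ N, ∀ i ≥ N, M (initSeg f i) = Part.some n) ∧ Wset n = Set.range f

/-- `M` TxtEx-learns the set `S`. -/
def TxtExLearnsSet (M : List ℕ →. ℕ) (S : Set ℕ) : Prop :=
  ∀ f : ℕ → ℕ, Set.range f = S → TxtExIdentifies M f

/-- `M` TxtBC-identifies the enumeration `f`. -/
def TxtBCIdentifies (M : List ℕ →. ℕ) (f : ℕ → ℕ) : Prop :=
  ∃ N, ∀ i ≥ N, ∃ h, M (initSeg f i) = Part.some h ∧ Wset h = Set.range f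

/-- `M` TxtBC-learns the set `S`. -/
def TxtBCLearnsSet (M : List ℕ →. ℕ) (S : Set ℕ) : Prop :=
  ∀ f : ℕ → ℕ, Set.range f = S → TxtBCIdentifies M f

/-- `M` TxtEx*-identifies the enumeration `f`. -/
def TxtExStarIdentifies (M : List ℕ →. ℕ) (f : ℕ → ℕ) : Prop :=
  ∃ n, (∃ N, ∀ i ≥ N, M (initSeg f i) = Part.some n) ∧
    (symmDiff (Wset n) (Set.range f)).Finite

/-- `M` TxtEx*-learns the set `S`. -/
def TxtExStarLearnsSet (M : List ℕ →. ℕ) (S : Set ℕ) : Prop :=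
  ∀ f : ℕ → ℕ, Set.range f = S → TxtExStarIdentifies M f

/-- Indices of cofinite c.e. sets. -/
def COF : Set ℕ := {e | (Wset e)ᶜ.Finite}

/-- Indices of coinfinite c.e. sets. -/
def COINF : Set ℕ := {e | (Wset e)ᶜ.Infinite}

/-- `P` is Σ⁰₃: definable by `∃∀∃` over a computable relation. -/
def IsSigma3 (P : Set ℕ) : Prop :=
  ∃ R : ℕ → ℕ → ℕ → ℕ → Bool,
    Computable (fun p : ℕ × ℕ × ℕ × ℕ => R p.1 p.2.1 p.2.2.1 p.2.2.2) ∧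
    ∀ e, e ∈ P ↔ ∃ x, ∀ y, ∃ z, R e x y z = true

/-- `P` is Σ⁰₄: definable by `∃∀∃∀` over a computable relation. -/
def IsSigma4 (P : Set ℕ) : Prop :=
  ∃ R : ℕ → ℕ → ℕ → ℕ → ℕ → Bool,
    Computable (fun p : ℕ × ℕ × ℕ × ℕ × ℕ =>
      R p.1 p.2.1 p.2.2.1 p.2.2.2.1 p.2.2.2.2) ∧
    ∀ e, e ∈ P ↔ ∃ x, ∀ y, ∃ z, ∀ w, R e x y z w = true

/-- `P` is Σ⁰₅: definable by `∃∀∃∀∃` over a computable relation. -/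
def IsSigma5 (P : Set ℕ) : Prop :=
  ∃ R : ℕ → ℕ → ℕ → ℕ → ℕ → ℕ → Bool,
    Computable (fun p : ℕ × ℕ × ℕ × ℕ × ℕ × ℕ =>
      R p.1 p.2.1 p.2.2.1 p.2.2.2.1 p.2.2.2.2.1 p.2.2.2.2.2) ∧
    ∀ e, e ∈ P ↔ ∃ x, ∀ y, ∃ z, ∀ w, ∃ v, R e x y z w v = true

/-- `f : ℕ → ℕ` is Δ⁰₂: the pointwise limit of a computable function. -/
def IsDelta2Fun (f : ℕ → ℕ) : Prop :=
  ∃ g : ℕ → ℕ → ℕ, Computable₂ g ∧ ∀ x, ∃ s₀, ∀ s ≥ s₀, g s x = f x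

/-- `H_x = {x+n : n ≤ card (W_x)}` (all of `{x+n : n ∈ ℕ}` when `W_x` is infinite). -/
def Hset (x : ℕ) : Set ℕ := {y | ∃ n : ℕ, (n : ℕ∞) ≤ (Wset x).encard ∧ y = x + n}

/-- `L_x = {x+n : n ∈ ℕ}`. -/
def Lset (x : ℕ) : Set ℕ := {y | ∃ n : ℕ, y = x + n}

/-- The family `F = {H_x : x ∈ ℕ} ∪ {L_x : x ∈ ℕ}`. -/
def Ffam : Set (Set ℕ) := {S | ∃ x, S = Hset x ∨ S = Lset x}

open Nat.Partrec in
/-- The number of elements of `Wset x` that are enumerated by stage `s`. -/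
def stageCard (x s : ℕ) : ℕ :=
  ((List.range s).filterMap (Code.evaln s (Denumerable.ofNat Code x))).length

open Nat.Partrec in
/-- The elements of `Wset x` that are enumerated by stage `s`. -/
def stageSet (x s : ℕ) : Finset ℕ :=
  (Finset.range s).filter fun n => (Code.evaln s (Denumerable.ofNat Code x) n).isSome

open Nat.Partrec in
theorem primrec₂_stageCard : Primrec₂ stageCard := by
  refine Primrec.list_length.comp (Primrec.listFilterMap (Primrec.list_range.comp Primrec.snd) ?_)
  exact Code.primrec_evaln.comp
    (((Primrec.snd.comp Primrec.fst).pair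
      ((Primrec.ofNat Code).comp (Primrec.fst.comp Primrec.fst))).pair Primrec.snd)

theorem card_stageSet (x s : ℕ) : (stageSet x s).card = stageCard x s := by
  rw [stageCard, List.length_filterMap_eq_countP, List.countP_eq_length_filter]
  simp only [stageSet, Finset.card, Finset.filter_val, Finset.range_val, Multiset.range,
    Multiset.filter_coe, Multiset.coe_card, Bool.decide_eq_true]

open Nat.Partrec in
theorem mem_stageSet {x s n : ℕ} :
    n ∈ stageSet x s ↔ ∃ v, v ∈ Code.evaln s (Denumerable.ofNat Code x) n := by
  simp only [stageSet, Finset.mem_filter, Finset.mem_range, Option.isSome_iff_exists]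
  exact ⟨fun h => h.2, fun ⟨v, hv⟩ => ⟨Code.evaln_bound hv, v, hv⟩⟩

theorem stageSet_mono (x : ℕ) : Monotone (stageSet x) := fun _ _ hst n hn => by
  obtain ⟨v, hv⟩ := mem_stageSet.1 hn
  exact mem_stageSet.2 ⟨v, Nat.Partrec.Code.evaln_mono hst hv⟩

theorem stageCard_mono (x : ℕ) : Monotone (stageCard x) := fun s t hst => by
  rw [← card_stageSet, ← card_stageSet]
  exact Finset.card_le_card (stageSet_mono x hst)

theorem mem_Wset_iff_exists_stageSet {x n : ℕ} : n ∈ Wset x ↔ ∃ s, n ∈ stageSet x s := by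
  simp only [mem_stageSet, Wset, Set.mem_ofPred_eq, Part.dom_iff_mem,
    Nat.Partrec.Code.evaln_complete]
  exact ⟨fun ⟨v, s, h⟩ => ⟨s, v, h⟩, fun ⟨s, v, h⟩ => ⟨v, s, h⟩⟩

theorem le_encard_Wset_iff {x k : ℕ} :
    (k : ℕ∞) ≤ (Wset x).encard ↔ ∃ s, k ≤ stageCard x s := by
  constructor
  · intro h
    obtain ⟨T, hT, hk⟩ := Set.exists_subset_encard_eq h
    have hfin : T.Finite := Set.finite_of_encard_eq_coe hk
    lift T to Finset ℕ using hfin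
    have hstage : ∀ n ∈ T, ∃ s, n ∈ stageSet x s :=
      fun n hn => mem_Wset_iff_exists_stageSet.1 (hT hn)
    choose! stage hstage using hstage
    refine ⟨T.sup stage, ?_⟩
    rw [Set.encard_coe_eq_coe_finsetCard, Nat.cast_inj] at hk
    rw [← hk, ← card_stageSet]
    exact Finset.card_le_card fun n hn => stageSet_mono x (Finset.le_sup hn) (hstage n hn)
  · rintro ⟨s, hs⟩
    have hsub : (stageSet x s : Set ℕ) ⊆ Wset x :=
      fun n hn => mem_Wset_iff_exists_stageSet.2 ⟨s, hn⟩
    refine le_trans ?_ (Set.encard_le_encard hsub)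
    rw [Set.encard_coe_eq_coe_finsetCard, card_stageSet]
    exact_mod_cast hs

/-- `i = ⟨x, b⟩` indexes `Hset x` if `b = 0` and `Lset x` otherwise. -/
def FfamMember (i : ℕ) : Set ℕ := if i.unpair.2 = 0 then Hset i.unpair.1 else Lset i.unpair.1

theorem FfamMember_pair_zero (x : ℕ) : FfamMember (Nat.pair x 0) = Hset x := by
  simp [FfamMember]

theorem FfamMember_pair_one (x : ℕ) : FfamMember (Nat.pair x 1) = Lset x := by
  simp [FfamMember]

theorem mem_Hset_iff {x y : ℕ} : y ∈ Hset x ↔ x ≤ y ∧ ∃ s, y - x ≤ stageCard x s := by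
  rw [← le_encard_Wset_iff]
  constructor
  · rintro ⟨n, hn, rfl⟩
    exact ⟨Nat.le_add_right _ _, by simpa using hn⟩
  · rintro ⟨hxy, h⟩
    exact ⟨y - x, h, by omega⟩

theorem mem_Lset_iff {x y : ℕ} : y ∈ Lset x ↔ x ≤ y := le_iff_exists_add.symm

theorem Hset_subset_Lset (x : ℕ) : Hset x ⊆ Lset x :=
  fun _ hy => mem_Lset_iff.2 (mem_Hset_iff.1 hy).1

theorem self_mem_Hset (x : ℕ) : x ∈ Hset x := mem_Hset_iff.2 ⟨le_rfl, 0, by simp⟩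

theorem mem_FfamMember_iff {i y : ℕ} :
    y ∈ FfamMember i ↔ ∃ s, i.unpair.1 ≤ y ∧
      (i.unpair.2 ≠ 0 ∨ y - i.unpair.1 ≤ stageCard i.unpair.1 s) := by
  unfold FfamMember
  split_ifs with h
  · simp [mem_Hset_iff, h]
  · simp [mem_Lset_iff, h]

theorem Ffam_eq_range_FfamMember : Ffam = {S | ∃ i, S = FfamMember i} := by
  ext S
  constructor
  · rintro ⟨x, rfl | rfl⟩
    · exact ⟨Nat.pair x 0, (FfamMember_pair_zero x).symm⟩
    · exact ⟨Nat.pair x 1, (FfamMember_pair_one x).symm⟩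
  · rintro ⟨i, rfl⟩
    refine ⟨i.unpair.1, ?_⟩
    unfold FfamMember
    split_ifs
    · exact Or.inl rfl
    · exact Or.inr rfl

open Nat.Partrec in
/-- A single code whose columns are the members of `Ffam`. -/
theorem exists_code_FfamMember :
    ∃ c : Code, ∀ i y, (c.eval (Nat.pair i y)).Dom ↔ y ∈ FfamMember i := by
  have hp : PrimrecRel fun z s : ℕ =>
      z.unpair.1.unpair.1 ≤ z.unpair.2 ∧ (¬ z.unpair.1.unpair.2 = 0 ∨
        z.unpair.2 - z.unpair.1.unpair.1 ≤ stageCard z.unpair.1.unpair.1 s) := by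
    have hi : Primrec fun p : ℕ × ℕ => p.1.unpair.1 :=
      Primrec.fst.comp (Primrec.unpair.comp Primrec.fst)
    have hy : Primrec fun p : ℕ × ℕ => p.1.unpair.2 :=
      Primrec.snd.comp (Primrec.unpair.comp Primrec.fst)
    have hx : Primrec fun p : ℕ × ℕ => p.1.unpair.1.unpair.1 :=
      Primrec.fst.comp (Primrec.unpair.comp hi)
    have hb : Primrec fun p : ℕ × ℕ => p.1.unpair.1.unpair.2 :=
      Primrec.snd.comp (Primrec.unpair.comp hi)
    exact (Primrec.nat_le.comp hx hy).and
      ((Primrec.eq.comp hb (Primrec.const 0)).not.or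
        (Primrec.nat_le.comp (Primrec.nat_sub.comp hy hx)
          (primrec₂_stageCard.comp hx Primrec.snd)))
  have hrec : Partrec fun z : ℕ => Nat.rfind fun s => Part.some (decide
      (z.unpair.1.unpair.1 ≤ z.unpair.2 ∧ (¬ z.unpair.1.unpair.2 = 0 ∨
        z.unpair.2 - z.unpair.1.unpair.1 ≤ stageCard z.unpair.1.unpair.1 s))) :=
    Partrec.rfind (Primrec.to_comp (PrimrecPred.decide hp)).partrec
  obtain ⟨c, hc⟩ := Code.exists_code.1 (Partrec.nat_iff.1 hrec)
  refine ⟨c, fun i y => ?_⟩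
  rw [hc, mem_FfamMember_iff]
  refine Nat.rfind_dom.trans ?_
  simp

/-- The greatest lower bound of the entries of a nonempty list. -/
def listMin (l : List ℕ) : ℕ := l.foldl min l.headI

/-- The least upper bound of the entries of a list. -/
def listMax (l : List ℕ) : ℕ := l.foldl max 0

theorem primrec_listMin : Primrec listMin :=
  Primrec.list_foldl Primrec.id Primrec.list_headI
    (Primrec.nat_min.comp (Primrec.fst.comp Primrec.snd) (Primrec.snd.comp Primrec.snd)).to₂

theorem primrec_listMax : Primrec listMax :=
  Primrec.list_foldl Primrec.id (Primrec.const 0)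
    (Primrec.nat_max.comp (Primrec.fst.comp Primrec.snd) (Primrec.snd.comp Primrec.snd)).to₂

theorem le_foldl_min_iff {l : List ℕ} {a n : ℕ} :
    n ≤ l.foldl min a ↔ n ≤ a ∧ ∀ y ∈ l, n ≤ y := by
  induction l generalizing a with
  | nil => simp
  | cons b l ih => simp [ih, and_assoc]

theorem foldl_max_le_iff {l : List ℕ} {a n : ℕ} :
    l.foldl max a ≤ n ↔ a ≤ n ∧ ∀ y ∈ l, y ≤ n := by
  induction l generalizing a with
  | nil => simp
  | cons b l ih => simp [ih, and_assoc]

theorem listMax_le_iff {l : List ℕ} {n : ℕ} : listMax l ≤ n ↔ ∀ y ∈ l, y ≤ n := by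
  simp [listMax, foldl_max_le_iff]

theorem listMin_eq {l : List ℕ} {x : ℕ} (hx : x ∈ l) (h : ∀ y ∈ l, x ≤ y) : listMin l = x := by
  apply le_antisymm
  · exact (le_foldl_min_iff.1 (le_refl (listMin l))).2 x hx
  · refine le_foldl_min_iff.2 ⟨h _ ?_, h⟩
    cases l with
    | nil => simp at hx
    | cons b l => simp

theorem mem_initSeg {f : ℕ → ℕ} {n y : ℕ} : y ∈ initSeg f n ↔ ∃ j < n, f j = y := by
  simp [initSeg]

theorem exists_forall_mem_initSeg {f : ℕ → ℕ} {y : ℕ} (hy : y ∈ Set.range f) :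
    ∃ N, ∀ i ≥ N, y ∈ initSeg f i := by
  obtain ⟨j, rfl⟩ := hy
  exact ⟨j + 1, fun i hi => mem_initSeg.2 ⟨j, hi, rfl⟩⟩

/-- The index `⟨x, b⟩` of the member of `Ffam` conjectured on the data `σ`: with `x` the least
datum, conjecture `Hset x` as long as the data fit its current approximation. -/
def conjecture (σ : List ℕ) : ℕ :=
  Nat.pair (listMin σ)
    (if listMax σ - listMin σ ≤ stageCard (listMin σ) σ.length then 0 else 1)

theorem primrec_conjecture : Primrec conjecture :=
  Primrec₂.natPair.comp primrec_listMin
    (Primrec.ite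
      (Primrec.nat_le.comp (Primrec.nat_sub.comp primrec_listMax primrec_listMin)
        (primrec₂_stageCard.comp primrec_listMin Primrec.list_length))
      (Primrec.const 0) (Primrec.const 1))

theorem FfamMember_conjecture (σ : List ℕ) :
    FfamMember (conjecture σ) =
      if listMax σ - listMin σ ≤ stageCard (listMin σ) σ.length then Hset (listMin σ)
      else Lset (listMin σ) := by
  unfold conjecture
  split_ifs
  · exact FfamMember_pair_zero _
  · exact FfamMember_pair_one _

theorem eventually_FfamMember_conjecture {f : ℕ → ℕ} (hf : Set.range f ∈ Ffam) :
    ∃ N, ∀ i ≥ N, FfamMember (conjecture (initSeg f i)) = Set.range f := by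
  obtain ⟨x, hS⟩ := hf
  have hx : x ∈ Set.range f := by
    rcases hS with hS | hS <;> rw [hS]
    · exact self_mem_Hset x
    · exact Hset_subset_Lset x (self_mem_Hset x)
  have hle : Set.range f ⊆ Lset x := by
    rcases hS with hS | hS <;> rw [hS]
    exact Hset_subset_Lset x
  have hmem : ∀ i, ∀ y ∈ initSeg f i, y ∈ Set.range f := fun i y hy => by
    obtain ⟨j, -, rfl⟩ := mem_initSeg.1 hy
    exact ⟨j, rfl⟩
  obtain ⟨N, hN⟩ := exists_forall_mem_initSeg hx
  have hmin : ∀ i ≥ N, listMin (initSeg f i) = x := fun i hi =>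
    listMin_eq (hN i hi) fun y hy => mem_Lset_iff.1 (hle (hmem i y hy))
  have hlen : ∀ i, (initSeg f i).length = i := fun i => by simp [initSeg]
  simp only [FfamMember_conjecture, hlen]
  by_cases hHL : Hset x = Lset x
  · refine ⟨N, fun i hi => ?_⟩
    rw [hmin i hi, hHL, ite_self]
    rcases hS with hS | hS <;> rw [hS]
    exact hHL.symm
  · obtain ⟨y, hyL, hyH⟩ : ∃ y, x ≤ y ∧ y ∉ Hset x := by
      by_contra! h
      exact hHL ((Hset_subset_Lset x).antisymm fun y hy => h y (mem_Lset_iff.1 hy))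
    have hlt : ∀ s, stageCard x s < y - x := fun s =>
      not_le.1 fun h => hyH (mem_Hset_iff.2 ⟨hyL, s, h⟩)
    rcases hS with hS | hS
    · have hfin : (Wset x).encard ≠ ⊤ := fun htop =>
        hyH ⟨y - x, by simp [htop], by omega⟩
      lift (Wset x).encard to ℕ using hfin with k hk
      obtain ⟨s, hs⟩ := le_encard_Wset_iff.1 hk.le
      refine ⟨max N s, fun i hi => ?_⟩
      rw [hmin i (le_of_max_le_left hi), if_pos, hS]
      have hki := hs.trans (stageCard_mono x (le_of_max_le_right hi))
      rw [tsub_le_iff_right, listMax_le_iff]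
      intro z hz
      obtain ⟨n, hn, rfl⟩ := hS ▸ hmem i z hz
      rw [← hk, Nat.cast_le] at hn
      omega
    · obtain ⟨N', hN'⟩ := exists_forall_mem_initSeg (f := f) (y := y)
        (hS ▸ mem_Lset_iff.2 hyL)
      refine ⟨max N N', fun i hi => ?_⟩
      rw [hmin i (le_of_max_le_left hi), if_neg, hS]
      have hy := listMax_le_iff.1 le_rfl y (hN' i (le_of_max_le_right hi))
      have := hlt i
      omega

/-- `F` is a u.c.e. family and is TxtBC-learnable. -/
theorem Ffam_uce_and_txtBC_learnable :
    (∃ a : ℕ, {S | ∃ i, S = column a i} = Ffam) ∧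
    (∃ M : List ℕ →. ℕ, Partrec M ∧ ∀ S ∈ Ffam, TxtBCLearnsSet M S) := by
  obtain ⟨c, hc⟩ := exists_code_FfamMember
  constructor
  · refine ⟨Encodable.encode c, ?_⟩
    have hcol : ∀ i, column (Encodable.encode c) i = FfamMember i := fun i => by
      ext y
      simp only [column, Wset, Set.mem_ofPred_eq, Denumerable.ofNat_encode, hc]
    simp only [hcol, Ffam_eq_range_FfamMember]
  · let g : List ℕ → ℕ := fun σ => Encodable.encode (Nat.Partrec.Code.curry c (conjecture σ))
    have hg : Primrec g := Primrec.encode.comp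
      (Nat.Partrec.Code.primrec₂_curry.comp (Primrec.const c) primrec_conjecture)
    have hW : ∀ σ, Wset (g σ) = FfamMember (conjecture σ) := fun σ => by
      ext y
      simp only [g, Wset, Set.mem_ofPred_eq, Denumerable.ofNat_encode,
        Nat.Partrec.Code.eval_curry, hc]
    refine ⟨fun σ => Part.some (g σ), hg.to_comp.partrec, ?_⟩
    rintro S hS f rfl
    obtain ⟨N, hN⟩ := eventually_FfamMember_conjecture hS
    exact ⟨N, fun i hi => ⟨_, rfl, (hW _).trans (hN i hi)⟩⟩
end

section
/- Let H_x = {x+n : n ≤ card(W_x)} (so H_x = {x+n : n ∈ ℕ} when W_x is infinite) and L_x = {x+n : n ∈ ℕ}. The family F = {H_x : x ∈ ℕ} ∪ {L_x : x ∈ ℕ} is not TxtEx-learnable: no computable learner TxtEx-learns F. -/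
open Nat.Partrec

/-- Two continuations of `σ` on which `K` converges to different values. -/
def Refuted (K : List ℕ →. ℕ) (σ : List ℕ) : Prop :=
  ∃ τ₁ τ₂ a b, a ∈ K (σ ++ τ₁) ∧ b ∈ K (σ ++ τ₂) ∧ a ≠ b

/-- The learner `M`, reading each datum shifted by `x`. -/
def shiftLearner (M : List ℕ →. ℕ) (x : ℕ) : List ℕ →. ℕ := fun σ => M (σ.map (x + ·))

theorem initSeg_shift (g : ℕ → ℕ) (x i : ℕ) :
    initSeg (fun n => x + g n) i = (initSeg g i).map (x + ·) := by
  simp [initSeg]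

theorem initSeg_append (f : ℕ → ℕ) {m n : ℕ} (h : m ≤ n) :
    ∃ τ, initSeg f n = initSeg f m ++ τ := by
  obtain ⟨k, rfl⟩ := Nat.exists_eq_add_of_le h
  exact ⟨((List.range k).map (m + ·)).map f, by simp [initSeg, List.range_add]⟩

theorem exists_initSeg_eq_of_chain (s : ℕ → List ℕ) (hs : ∀ n, s n <+: s (n + 1))
    (hl : ∀ n, n ≤ (s n).length) : ∃ g : ℕ → ℕ, ∀ n, initSeg g (s n).length = s n := by
  have mono : ∀ m n, m ≤ n → s m <+: s n := fun m n h =>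
    Nat.le_induction (List.prefix_refl _) (fun k _ ih => ih.trans (hs k)) n h
  refine ⟨fun i => (s (i + 1)).getD i 0, fun n => ?_⟩
  apply List.ext_getElem
  · simp [initSeg]
  · intro i h₁ h₂
    have h₃ : i < (s (i + 1)).length := hl (i + 1)
    simp only [initSeg, List.getElem_map, List.getElem_range]
    rw [List.getD_eq_getElem _ _ h₃]
    rcases le_total (i + 1) n with h | h
    · exact (mono _ _ h).getElem h₃
    · exact ((mono _ _ h).getElem h₂).symm

theorem exists_text_extending {S : Set ℕ} (σ : List ℕ) (hS : S.Nonempty) (hσ : ∀ a ∈ σ, a ∈ S) :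
    ∃ g : ℕ → ℕ, Set.range g = S ∧ initSeg g σ.length = σ := by
  obtain ⟨e, rfl⟩ := S.to_countable.exists_eq_range hS
  refine ⟨fun i => if h : i < σ.length then σ[i] else e (i - σ.length), ?_, ?_⟩
  · ext a
    constructor
    · rintro ⟨i, rfl⟩
      dsimp only
      split_ifs with h
      · exact hσ _ (List.getElem_mem h)
      · exact ⟨_, rfl⟩
    · rintro ⟨i, rfl⟩
      exact ⟨σ.length + i, by simp⟩
  · apply List.ext_getElem
    · simp [initSeg]
    · intro i h₁ h₂
      simp [initSeg, h₂]

theorem exists_nonconvergent_text {K : List ℕ →. ℕ} (hK : ∀ σ, Refuted K σ) :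
    ∃ g : ℕ → ℕ, Set.range g = Set.univ ∧
      ¬ ∃ h N, ∀ i ≥ N, K (initSeg g i) = Part.some h := by
  have step : ∀ (σ : List ℕ) (v : ℕ), ∃ τ a, a ∈ K (σ ++ τ) ∧ a ≠ v := by
    intro σ v
    obtain ⟨τ₁, τ₂, a, b, ha, hb, hab⟩ := hK σ
    by_cases h : a = v
    · exact ⟨τ₂, b, hb, fun h' => hab (h.trans h'.symm)⟩
    · exact ⟨τ₁, a, ha, h⟩
  choose T A hA hne using step
  obtain ⟨s, hs⟩ : ∃ s : ℕ → List ℕ × ℕ, ∀ n, s (n + 1) =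
      ((s n).1 ++ [n] ++ T ((s n).1 ++ [n]) (s n).2, A ((s n).1 ++ [n]) (s n).2) :=
    ⟨fun n => Nat.rec ([], 0)
      (fun n p => (p.1 ++ [n] ++ T (p.1 ++ [n]) p.2, A (p.1 ++ [n]) p.2)) n, fun _ => rfl⟩
  have hlen : ∀ n, n ≤ (s n).1.length := by
    intro n
    induction n with
    | zero => simp
    | succ n ih => rw [hs]; simp only [List.length_append, List.length_singleton]; omega
  obtain ⟨g, hg⟩ : ∃ g : ℕ → ℕ, ∀ n, initSeg g (s n).1.length = (s n).1 :=
    exists_initSeg_eq_of_chain (fun n => (s n).1)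
    (fun n => ⟨[n] ++ T ((s n).1 ++ [n]) (s n).2, by simp [hs]⟩) hlen
  refine ⟨g, ?_, ?_⟩
  · refine Set.eq_univ_of_forall fun n => ?_
    have hn : n ∈ initSeg g (s (n + 1)).1.length := by rw [hg]; simp [hs]
    simp only [initSeg, List.mem_map] at hn
    obtain ⟨i, -, hi⟩ := hn
    exact ⟨i, hi⟩
  · rintro ⟨h, N, hN⟩
    have val : ∀ n, N ≤ n → (s (n + 1)).2 = h := by
      intro n hn
      have h₁ : (s (n + 1)).2 ∈ K (s (n + 1)).1 := by rw [hs]; exact hA _ _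
      have h₂ := hN (s (n + 1)).1.length (by have := hlen (n + 1); omega)
      rw [hg] at h₂
      rw [h₂] at h₁
      exact Part.mem_some_iff.1 h₁
    have heq := (val (N + 1) (by omega)).trans (val N le_rfl).symm
    rw [hs (N + 1)] at heq
    exact hne _ _ heq

/-- The limits of `K` on two texts extending an unrefuted sequence agree. -/
theorem limit_eq_of_not_refuted {K : List ℕ →. ℕ} {σ : List ℕ} (hσ : ¬ Refuted K σ)
    {g₁ g₂ : ℕ → ℕ} (h₁ : initSeg g₁ σ.length = σ) (h₂ : initSeg g₂ σ.length = σ) {a b N₁ N₂ : ℕ}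
    (ha : ∀ i ≥ N₁, K (initSeg g₁ i) = Part.some a)
    (hb : ∀ i ≥ N₂, K (initSeg g₂ i) = Part.some b) : a = b := by
  by_contra hab
  obtain ⟨τ₁, e₁⟩ := initSeg_append g₁ (le_max_left σ.length N₁)
  obtain ⟨τ₂, e₂⟩ := initSeg_append g₂ (le_max_left σ.length N₂)
  have ha' := ha _ (le_max_right σ.length N₁)
  have hb' := hb _ (le_max_right σ.length N₂)
  rw [e₁, h₁] at ha'
  rw [e₂, h₂] at hb'
  exact hσ ⟨τ₁, τ₂, a, b, by simp [ha'], by simp [hb'], hab⟩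

theorem le_of_mem_ofNat_list {k a : ℕ} (h : a ∈ Denumerable.ofNat (List ℕ) k) : a ≤ k := by
  have key : ∀ (l : List ℕ) (a : ℕ), a ∈ l → a ≤ Encodable.encode l := by
    intro l
    induction l with
    | nil => simp
    | cons b l ih =>
      intro a ha
      rw [Encodable.encode_list_cons]
      have h₁ := Nat.left_le_pair (Encodable.encode b) (Encodable.encode l)
      have h₂ := Nat.right_le_pair (Encodable.encode b) (Encodable.encode l)
      rcases List.mem_cons.1 ha with rfl | ha
      · exact h₁.trans (Nat.le_succ _)
      · exact (ih a ha).trans (h₂.trans (Nat.le_succ _))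
  simpa using key _ a h

/-- Whether the witness `w` shows, within its time bound, that the `k`-th sequence is refuted for
the learner with code `m` shifted by `x`. -/
def refutes (m : Code) (x k w : ℕ) : Bool :=
  let p := Denumerable.ofNat (ℕ × List ℕ × List ℕ) w
  let q := fun τ : List ℕ => m.evaln p.1
    (Encodable.encode ((Denumerable.ofNat (List ℕ) k ++ τ).map (x + ·)))
  (q p.2.1).isSome && ((q p.2.2).isSome && !decide (q p.2.1 = q p.2.2))

theorem primrec_refutes (m : Code) :
    Primrec fun p : (ℕ × ℕ) × ℕ => refutes m p.1.1 p.1.2 p.2 := by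
  have hp : Primrec fun p : (ℕ × ℕ) × ℕ => Denumerable.ofNat (ℕ × List ℕ × List ℕ) p.2 :=
    (Primrec.ofNat _).comp Primrec.snd
  have hq : ∀ {t : (ℕ × ℕ) × ℕ → List ℕ}, Primrec t → Primrec fun p : (ℕ × ℕ) × ℕ =>
      m.evaln (Denumerable.ofNat (ℕ × List ℕ × List ℕ) p.2).1
        (Encodable.encode ((Denumerable.ofNat (List ℕ) p.1.2 ++ t p).map (p.1.1 + ·))) := by
    intro t ht
    refine Code.primrec_evaln.comp
      (((Primrec.fst.comp hp).pair (Primrec.const m)).pair (Primrec.encode.comp ?_))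
    refine Primrec.list_map (Primrec.list_append.comp
      ((Primrec.ofNat _).comp (Primrec.snd.comp Primrec.fst)) ht) ?_
    exact Primrec.nat_add.comp ((Primrec.fst.comp Primrec.fst).comp Primrec.fst) Primrec.snd
  have h₁ := hq (Primrec.fst.comp (Primrec.snd.comp hp))
  have h₂ := hq (Primrec.snd.comp (Primrec.snd.comp hp))
  exact Primrec.and.comp (Primrec.option_isSome.comp h₁) (Primrec.and.comp
    (Primrec.option_isSome.comp h₂) (Primrec.not.comp (Primrec.eq.decide.comp h₁ h₂)))

theorem exists_refutes_iff {M : List ℕ →. ℕ} {m : Code}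
    (hm : ∀ σ, m.eval (Encodable.encode σ) = M σ) (x k : ℕ) :
    (∃ w, refutes m x k w = true) ↔
      Refuted (shiftLearner M x) (Denumerable.ofNat (List ℕ) k) := by
  constructor
  · rintro ⟨w, hw⟩
    simp only [refutes, Bool.and_eq_true, Option.isSome_iff_exists, Bool.not_eq_true',
      decide_eq_false_iff_not] at hw
    obtain ⟨⟨a, ha⟩, ⟨b, hb⟩, hab⟩ := hw
    let p := Denumerable.ofNat (ℕ × List ℕ × List ℕ) w
    refine ⟨p.2.1, p.2.2, a, b, ?_, ?_, fun h => hab (by rw [ha, hb, h])⟩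
    · rw [shiftLearner, ← hm]; exact Code.evaln_sound ha
    · rw [shiftLearner, ← hm]; exact Code.evaln_sound hb
  · rintro ⟨τ₁, τ₂, a, b, ha, hb, hab⟩
    rw [shiftLearner, ← hm] at ha hb
    obtain ⟨s₁, h₁⟩ := Code.evaln_complete.1 ha
    obtain ⟨s₂, h₂⟩ := Code.evaln_complete.1 hb
    have h₁' := Option.mem_def.1 (Code.evaln_mono (le_max_left s₁ s₂) h₁)
    have h₂' := Option.mem_def.1 (Code.evaln_mono (le_max_right s₁ s₂) h₂)
    refine ⟨Encodable.encode (max s₁ s₂, τ₁, τ₂), ?_⟩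
    simp only [refutes, Denumerable.ofNat_encode]
    rw [h₁', h₂']
    simpa using hab

theorem exists_wset_eq_refuted {M : List ℕ →. ℕ} (hM : Partrec M) :
    ∃ x, Wset x =
      {n | ∀ k < n, Refuted (shiftLearner M x) (Denumerable.ofNat (List ℕ) k)} := by
  obtain ⟨m, hm'⟩ := Code.exists_code.1 hM
  have hm : ∀ σ, m.eval (Encodable.encode σ) = M σ := by
    intro σ
    rw [hm']
    simp [Part.map_id']
  let search : Code × ℕ → ℕ →. ℕ := fun p k =>
    Nat.rfind fun w => Part.some (refutes m (Encodable.encode p.1) k w)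
  let F : Code → ℕ →. ℕ := fun c n =>
    Nat.rec (Part.some 0) (fun k ih => ih.bind fun _ => search (c, n) k) n
  have hF : Partrec₂ F := by
    refine Partrec.nat_rec (f := fun p : Code × ℕ => p.2) (g := fun _ => Part.some 0)
      (h := fun p q => search p q.1) Computable.snd (Computable.const 0).partrec ?_
    refine Partrec.rfind ?_
    refine Computable.partrec ?_
    exact ((primrec_refutes m).comp (Primrec.pair (Primrec.pair
      (Primrec.encode.comp (Primrec.fst.comp (Primrec.fst.comp Primrec.fst)))
      (Primrec.fst.comp (Primrec.snd.comp Primrec.fst))) Primrec.snd)).to_comp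
  have dom : ∀ c n j, (Nat.rec (Part.some 0) (fun k ih => ih.bind fun _ => search (c, n) k) j :
      Part ℕ).Dom ↔ ∀ k < j,
        Refuted (shiftLearner M (Encodable.encode c)) (Denumerable.ofNat (List ℕ) k) := by
    intro c n j
    induction j with
    | zero => simp
    | succ j ih =>
      have hsearch : (search (c, n) j).Dom ↔ Refuted (shiftLearner M (Encodable.encode c))
          (Denumerable.ofNat (List ℕ) j) := by
        rw [← exists_refutes_iff hm]
        exact Nat.rfind_dom.trans (by simp)
      rw [Nat.forall_lt_succ_right, ← ih, ← hsearch]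
      simp [Part.bind_dom]
  obtain ⟨c, hc⟩ := Code.fixed_point₂ hF
  refine ⟨Encodable.encode c, Set.ext fun n => ?_⟩
  simp only [Wset, Denumerable.ofNat_encode, hc, Set.mem_ofPred_eq]
  exact dom c n n

theorem TxtExLearnsSet.exists_limit {M : List ℕ →. ℕ} {x : ℕ} {S : Set ℕ}
    (hM : TxtExLearnsSet M ((x + ·) '' S)) {g : ℕ → ℕ} (hg : Set.range g = S) :
    ∃ h, (∃ N, ∀ i ≥ N, shiftLearner M x (initSeg g i) = Part.some h) ∧
      Wset h = (x + ·) '' S := by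
  have hr : Set.range (fun n => x + g n) = (x + ·) '' S := by
    rw [← hg, ← Set.range_comp]; rfl
  obtain ⟨h, ⟨N, hN⟩, hW⟩ := hM _ hr
  exact ⟨h, ⟨N, fun i hi => by rw [shiftLearner, ← initSeg_shift]; exact hN i hi⟩, hW.trans hr⟩

theorem Lset_eq_image (x : ℕ) : Lset x = (x + ·) '' Set.univ := by
  ext y; simp [Lset, eq_comm]

theorem Hset_eq_image {x k : ℕ} (hx : (Wset x).encard = k + 1) :
    Hset x = (x + ·) '' Set.Iic (k + 1) := by
  ext y
  simp only [Hset, hx, Set.mem_ofPred_eq, Set.mem_image, Set.mem_Iic, eq_comm (a := y)]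
  norm_cast

/-- No computable learner TxtEx-learns `F`. -/
theorem Ffam_not_txtEx_learnable :
    ¬ ∃ M : List ℕ →. ℕ, Partrec M ∧ ∀ S ∈ Ffam, TxtExLearnsSet M S := by
  rintro ⟨M, hM, hlearn⟩
  obtain ⟨x, hx⟩ := exists_wset_eq_refuted hM
  have hL := hlearn _ ⟨x, Or.inr rfl⟩
  rw [Lset_eq_image] at hL
  by_cases hall : ∀ σ, Refuted (shiftLearner M x) σ
  · obtain ⟨g, hg, hdiv⟩ := exists_nonconvergent_text hall
    obtain ⟨h, hconv, -⟩ := hL.exists_limit hg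
    exact hdiv ⟨h, hconv⟩
  · have hex : ∃ k, ¬ Refuted (shiftLearner M x) (Denumerable.ofNat (List ℕ) k) := by
      push Not at hall
      obtain ⟨σ, hσ⟩ := hall
      exact ⟨Encodable.encode σ, by rwa [Denumerable.ofNat_encode]⟩
    classical
    obtain ⟨k, hk, hmin⟩ : ∃ k, ¬ Refuted (shiftLearner M x) (Denumerable.ofNat (List ℕ) k) ∧
        ∀ j < k, Refuted (shiftLearner M x) (Denumerable.ofNat (List ℕ) j) :=
      ⟨Nat.find hex, Nat.find_spec hex, fun j hj => not_not.1 (Nat.find_min hex hj)⟩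
    have hW : Wset x = Set.Iic k := by
      rw [hx]
      ext n
      simp only [Set.mem_ofPred_eq, Set.mem_Iic]
      exact ⟨fun h => not_lt.1 fun hn => hk (h k hn), fun h j hj => hmin j (hj.trans_le h)⟩
    have hcard : (Wset x).encard = k + 1 := by
      rw [hW, ← Finset.coe_Iic, Set.encard_coe_eq_coe_finsetCard, Nat.card_Iic]
      norm_cast
    have hH := hlearn _ ⟨x, Or.inl rfl⟩
    rw [Hset_eq_image hcard] at hH
    obtain ⟨g₁, hg₁, he₁⟩ := exists_text_extending (S := Set.univ)
      (Denumerable.ofNat (List ℕ) k) Set.univ_nonempty (fun _ _ => Set.mem_univ _)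
    obtain ⟨g₂, hg₂, he₂⟩ := exists_text_extending (S := Set.Iic (k + 1))
      (Denumerable.ofNat (List ℕ) k) Set.nonempty_Iic
      (fun _ ha => (le_of_mem_ofNat_list ha).trans (Nat.le_succ k))
    obtain ⟨a, ⟨N₁, ha⟩, hWa⟩ := hL.exists_limit hg₁
    obtain ⟨b, ⟨N₂, hb⟩, hWb⟩ := hH.exists_limit hg₂
    obtain rfl := limit_eq_of_not_refuted hk he₁ he₂ ha hb
    have huniv : (Set.univ : Set ℕ) = Set.Iic (k + 1) :=
      (add_right_injective x).image_injective (hWa.symm.trans hWb)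
    exact Set.infinite_univ (huniv ▸ Set.finite_Iic (k + 1))
end

section
/- For every Σ⁰₄ set Q there is a computable function g : ℕ × ℕ → ℕ such that: if e ∈ Q then there is exactly one x with g(e,x) ∈ COINF, and if e ∉ Q then g(e,x) ∈ COF for every x. -/
/-- The list `l` selects, at each of its positions `i`, a value related to `i` by `F`. -/
def IsSelection {α : Type*} (F : ℕ → α → Prop) (l : List α) : Prop :=
  ∀ i a, l[i]? = some a → F i a

namespace IsSelection

variable {α : Type*} {F : ℕ → α → Prop}

theorem eq_of_length_eq (hF : ∀ i a b, F i a → F i b → a = b) {l l' : List α}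
    (hl : IsSelection F l) (hl' : IsSelection F l') (h : l.length = l'.length) : l = l' := by
  refine List.ext_getElem h fun i h₁ h₂ => ?_
  exact hF i _ _ (hl i _ (List.getElem?_eq_getElem h₁)) (hl' i _ (List.getElem?_eq_getElem h₂))

theorem exists_of_length {n : ℕ} (h : ∀ i < n, ∃ a, F i a) :
    ∃ l, IsSelection F l ∧ l.length = n := by
  induction n with
  | zero => exact ⟨[], by simp [IsSelection], rfl⟩
  | succ n ih =>
    obtain ⟨l, hl, rfl⟩ := ih fun i hi => h i (by omega)
    obtain ⟨a, ha⟩ := h l.length (by omega)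
    refine ⟨l ++ [a], fun i b hb => ?_, by simp⟩
    rcases lt_trichotomy i l.length with hi | rfl | hi
    · rw [List.getElem?_append_left hi] at hb
      exact hl i b hb
    · simp at hb
      exact hb ▸ ha
    · rw [List.getElem?_eq_none (by simp; omega)] at hb
      cases hb

theorem exists_apply (h : ∀ i, ∃ a, F i a) (n : ℕ) : ∃ l, IsSelection F l ∧ l.length = n :=
  exists_of_length fun i _ => h i

theorem exists_of_mem {l : List α} (hl : IsSelection F l) {i : ℕ} (hi : i < l.length) :
    ∃ a, F i a :=
  ⟨_, hl i _ (List.getElem?_eq_getElem hi)⟩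

/-- If `F` is functional, then the selections for `F` are infinitely many exactly when
`F` is total. -/
theorem infinite_iff (hF : ∀ i a b, F i a → F i b → a = b) :
    {l | IsSelection F l}.Infinite ↔ ∀ i, ∃ a, F i a := by
  constructor
  · intro h i
    by_contra hi
    refine h (Set.Finite.of_finite_image (f := List.length) ?_ ?_)
    · refine (Set.finite_Iic i).subset ?_
      rintro _ ⟨l, hl, rfl⟩
      exact not_lt.1 fun hlt => hi (exists_of_mem hl hlt)
    · exact fun l hl l' hl' h => eq_of_length_eq hF hl hl' h
  · intro h
    choose l hl hlen using exists_apply h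
    exact Set.infinite_of_injective_forall_mem
      (fun m n hmn => by rw [← hlen m, ← hlen n, hmn]) hl

/-- If `F` is functional, then at most one selection for `F` has a length outside of the
domain of `F`. -/
theorem eq_of_forall_not (hF : ∀ i a b, F i a → F i b → a = b) {l l' : List α}
    (hl : IsSelection F l) (hn : ∀ a, ¬ F l.length a)
    (hl' : IsSelection F l') (hn' : ∀ a, ¬ F l'.length a) : l = l' := by
  refine eq_of_length_eq hF hl hl' (le_antisymm ?_ ?_) <;> refine not_lt.1 fun h => ?_
  · obtain ⟨a, ha⟩ := exists_of_mem hl h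
    exact hn' a ha
  · obtain ⟨a, ha⟩ := exists_of_mem hl' h
    exact hn a ha

theorem exists_forall_not (h : ∃ i, ∀ a, ¬ F i a) :
    ∃ l, IsSelection F l ∧ ∀ a, ¬ F l.length a := by
  classical
  obtain ⟨l, hl, hlen⟩ := exists_of_length (F := F) (n := Nat.find h) fun i hi => by
    simpa using Nat.find_min h hi
  exact ⟨l, hl, hlen ▸ Nat.find_spec h⟩

end IsSelection

/-- `a` is the least number at which `p` fails. -/
def IsLeastFailure (p : ℕ → Prop) (a : ℕ) : Prop :=
  (∀ b < a, p b) ∧ ¬ p a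

namespace IsLeastFailure

variable {p : ℕ → Prop}

theorem unique {a b : ℕ} (ha : IsLeastFailure p a) (hb : IsLeastFailure p b) : a = b :=
  le_antisymm (not_lt.1 fun h => hb.2 (ha.1 _ h)) (not_lt.1 fun h => ha.2 (hb.1 _ h))

theorem forall_not_iff : (∀ a, ¬ IsLeastFailure p a) ↔ ∀ a, p a := by
  classical
  constructor
  · intro h
    by_contra! hp
    exact h (Nat.find hp) ⟨fun b hb => not_not.1 (Nat.find_min hp hb), Nat.find_spec hp⟩
  · exact fun h a ha => ha.2 (h a)

end IsLeastFailure

/-- The list `l` certifies that its length is the least `i` with `∀ j, p i j`: below its length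
it lists the least failures of the predicates `p i`. -/
def IsLeastWitness (p : ℕ → ℕ → Prop) (l : List ℕ) : Prop :=
  IsSelection (fun i => IsLeastFailure (p i)) l ∧ ∀ j, p l.length j

namespace IsLeastWitness

variable {p : ℕ → ℕ → Prop}

theorem unique {l l' : List ℕ} (hl : IsLeastWitness p l) (hl' : IsLeastWitness p l') : l = l' :=
  IsSelection.eq_of_forall_not (F := fun i => IsLeastFailure (p i))
    (fun _ _ _ => IsLeastFailure.unique)
    hl.1 (IsLeastFailure.forall_not_iff.2 hl.2) hl'.1 (IsLeastFailure.forall_not_iff.2 hl'.2)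

theorem exists_iff : (∃ l, IsLeastWitness p l) ↔ ∃ i, ∀ j, p i j := by
  constructor
  · rintro ⟨l, hl⟩
    exact ⟨_, hl.2⟩
  · rintro ⟨i, hi⟩
    obtain ⟨l, hl, hn⟩ := IsSelection.exists_forall_not
      (F := fun i => IsLeastFailure (p i)) ⟨i, IsLeastFailure.forall_not_iff.2 hi⟩
    exact ⟨l, hl, IsLeastFailure.forall_not_iff.1 hn⟩

end IsLeastWitness

/-- Uniformly c.e. sets have a computable sequence of indices. -/
theorem exists_computable_index {α : Type*} [Primcodable α]
    {B : α → ℕ → ℕ → Bool} (hB : Computable fun q : (α × ℕ) × ℕ => B q.1.1 q.1.2 q.2) :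
    ∃ f : α → ℕ, Computable f ∧ ∀ a, Wset (f a) = {x | ∃ t, B a x t = true} := by
  have hr : Partrec fun q : α × ℕ => Nat.rfind fun t => Part.some (B q.1 q.2 t) :=
    Partrec.rfind (p := fun (q : α × ℕ) t => Part.some (B q.1 q.2 t)) hB
  obtain ⟨c, hc⟩ := Nat.Partrec.Code.exists_code.1 hr
  refine ⟨fun a => Encodable.encode (c.curry (Encodable.encode a)), ?_, fun a => ?_⟩
  · exact Computable.encode.comp (Nat.Partrec.Code.primrec₂_curry.to_comp.comp
      (Computable.const c) Computable.encode)
  · ext x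
    simp only [Wset, Set.mem_ofPred_eq, Denumerable.ofNat_encode, Nat.Partrec.Code.eval_curry, hc]
    simpa using Nat.rfind_dom (p := fun t => Part.some (B a x t))

/-- A version of `Computable.ofNat` for an arbitrary `Primcodable` structure on a
denumerable type. -/
theorem computable_of_decode_eq {α : Type*} [Primcodable α] {d : ℕ → α}
    (hd : ∀ n, Encodable.decode n = some (d n)) : Computable d :=
  (Computable.option_getD Computable.decode (Computable.const (d 0))).of_eq fun n => by
    simp [hd]

theorem computable_ofNat_prod : Computable (Denumerable.ofNat (ℕ × ℕ)) :=
  computable_of_decode_eq fun n => Denumerable.decode_eq_ofNat _ n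

theorem computable_ofNat_triple : Computable (Denumerable.ofNat (ℕ × ℕ × ℕ)) :=
  computable_of_decode_eq fun n => Denumerable.decode_eq_ofNat _ n

theorem computable_ofNat_list : Computable (Denumerable.ofNat (List ℕ)) :=
  computable_of_decode_eq fun n => Denumerable.decode_eq_ofNat _ n

theorem computable_ofNat_list_list : Computable (Denumerable.ofNat (List (List ℕ))) :=
  computable_of_decode_eq fun n => Denumerable.decode_eq_ofNat _ n

section

variable {α : Type*} [Primcodable α] {p q : α → Bool}

theorem computable_and (hp : Computable p) (hq : Computable q) :
    Computable fun a => p a && q a :=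
  Primrec.and.to_comp.comp hp hq

theorem computable_or (hp : Computable p) (hq : Computable q) :
    Computable fun a => p a || q a :=
  Primrec.or.to_comp.comp hp hq

theorem computable_not (hp : Computable p) : Computable fun a => !p a :=
  Primrec.not.to_comp.comp hp

end

/-- At stage `(i, j, w)`, refute that `L` selects least witnesses for the predicates
`fun v => ∀ w, T a i v w`. -/
def refuteSelection {α : Type*} (T : α → ℕ → ℕ → ℕ → Bool) (a : α) (L : List (List ℕ))
    (q : ℕ × ℕ × ℕ) : Bool :=
  decide (q.1 < L.length) && !(T a q.1 (L.getD q.1 []).length q.2.2 &&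
    (!(decide (q.2.1 < (L.getD q.1 []).length)) ||
      (!(T a q.1 q.2.1 ((L.getD q.1 []).getD q.2.1 0)) &&
        (!(decide (q.2.2 < (L.getD q.1 []).getD q.2.1 0)) || T a q.1 q.2.1 q.2.2))))

theorem computable_refuteSelection {α : Type*} [Primcodable α] {T : α → ℕ → ℕ → ℕ → Bool}
    (hT : Computable fun q : α × ℕ × ℕ × ℕ => T q.1 q.2.1 q.2.2.1 q.2.2.2) :
    Computable fun q : (α × List (List ℕ)) × ℕ × ℕ × ℕ => refuteSelection T q.1.1 q.1.2 q.2 := by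
  have ha : Computable fun q : (α × List (List ℕ)) × ℕ × ℕ × ℕ => q.1.1 :=
    Computable.fst.comp Computable.fst
  have hL : Primrec fun q : (α × List (List ℕ)) × ℕ × ℕ × ℕ => q.1.2 :=
    Primrec.snd.comp Primrec.fst
  have hi : Primrec fun q : (α × List (List ℕ)) × ℕ × ℕ × ℕ => q.2.1 :=
    Primrec.fst.comp Primrec.snd
  have hj : Primrec fun q : (α × List (List ℕ)) × ℕ × ℕ × ℕ => q.2.2.1 :=
    Primrec.fst.comp (Primrec.snd.comp Primrec.snd)
  have hw : Primrec fun q : (α × List (List ℕ)) × ℕ × ℕ × ℕ => q.2.2.2 :=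
    Primrec.snd.comp (Primrec.snd.comp Primrec.snd)
  have hl : Primrec fun q : (α × List (List ℕ)) × ℕ × ℕ × ℕ => q.1.2.getD q.2.1 [] :=
    (Primrec.list_getD []).comp hL hi
  have hb : Primrec fun q : (α × List (List ℕ)) × ℕ × ℕ × ℕ =>
      (q.1.2.getD q.2.1 []).getD q.2.2.1 0 := (Primrec.list_getD 0).comp hl hj
  have hlen := Primrec.list_length.comp hl
  have hTc {v w : (α × List (List ℕ)) × ℕ × ℕ × ℕ → ℕ} (hv : Primrec v) (hw : Primrec w) :
      Computable fun q => T q.1.1 q.2.1 (v q) (w q) :=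
    hT.comp (ha.pair (hi.to_comp.pair (hv.to_comp.pair hw.to_comp)))
  have hlt {v w : (α × List (List ℕ)) × ℕ × ℕ × ℕ → ℕ} (hv : Primrec v) (hw : Primrec w) :
      Computable fun q => decide (v q < w q) :=
    (Primrec.nat_lt.comp hv hw).decide.to_comp
  exact computable_and (hlt hi (Primrec.list_length.comp hL))
    (computable_not (computable_and (hTc hlen hw)
      (computable_or (computable_not (hlt hj hlen))
        (computable_and (computable_not (hTc hj hb))
          (computable_or (computable_not (hlt hw hb)) (hTc hj hw))))))

theorem isSelection_iff_refuteSelection {α : Type*} (T : α → ℕ → ℕ → ℕ → Bool) (a : α)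
    (L : List (List ℕ)) :
    IsSelection (fun i => IsLeastWitness fun v w => T a i v w = true) L ↔
      ∀ q, ¬ refuteSelection T a L q = true := by
  constructor
  · rintro hL ⟨i, j, w⟩
    by_cases hi : i < L.length
    · obtain ⟨h₁, h₂⟩ := hL i _ (List.getElem?_eq_getElem hi)
      by_cases hj : j < L[i].length
      · obtain ⟨h₃, h₄⟩ := h₁ j _ (List.getElem?_eq_getElem hj)
        have h₅ := h₃ w
        simp_all [refuteSelection]
      · simp_all [refuteSelection]
    · simp [refuteSelection, hi]
  · intro h i l hl
    obtain ⟨hi, rfl⟩ := List.getElem?_eq_some_iff.1 hl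
    refine ⟨fun j b hb => ?_, fun w => ?_⟩
    · obtain ⟨hj, rfl⟩ := List.getElem?_eq_some_iff.1 hb
      refine ⟨fun w hw => ?_, ?_⟩
      · have := h (i, j, w)
        simp_all [refuteSelection]
      · have := h (i, j, 0)
        simp_all [refuteSelection]
    · have := h (i, 0, w)
      simp_all [refuteSelection]

/-- Every `Π⁰₃` predicate reduces to membership in `COINF`. -/
theorem exists_computable_mem_COINF_iff {α : Type*} [Primcodable α]
    {T : α → ℕ → ℕ → ℕ → Bool}
    (hT : Computable fun q : α × ℕ × ℕ × ℕ => T q.1 q.2.1 q.2.2.1 q.2.2.2) :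
    ∃ f : α → ℕ, Computable f ∧
      ∀ a, f a ∈ COINF ↔ ∀ u, ∃ v, ∀ w, T a u v w = true := by
  have hdec : Computable fun q : (α × ℕ) × ℕ =>
      ((q.1.1, Denumerable.ofNat (List (List ℕ)) q.1.2), Denumerable.ofNat (ℕ × ℕ × ℕ) q.2) :=
    ((Computable.fst.comp Computable.fst).pair
      (computable_ofNat_list_list.comp (Computable.snd.comp Computable.fst))).pair
        (computable_ofNat_triple.comp Computable.snd)
  have hB := (computable_refuteSelection hT).comp hdec
  obtain ⟨f, hf, hfW⟩ := exists_computable_index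
    (B := fun a x t => refuteSelection T a (Denumerable.ofNat (List (List ℕ)) x)
      (Denumerable.ofNat (ℕ × ℕ × ℕ) t)) hB
  refine ⟨f, hf, fun a => ?_⟩
  let F : ℕ → List ℕ → Prop := fun i => IsLeastWitness fun v w => T a i v w = true
  have hcompl : (Wset (f a))ᶜ = Denumerable.eqv (List (List ℕ)) '' {L | IsSelection F L} := by
    ext x
    rw [Equiv.image_eq_preimage_symm]
    simp only [hfW, Set.mem_compl_iff, Set.mem_ofPred_eq, Set.mem_preimage, F,
      isSelection_iff_refuteSelection, not_exists]
    constructor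
    · intro h q
      rw [← Denumerable.ofNat_encode q]
      exact h _
    · exact fun h t => h _
  change (Wset (f a))ᶜ.Infinite ↔ _
  rw [hcompl, Set.infinite_image_iff (Equiv.injective _).injOn,
    IsSelection.infinite_iff (F := F) fun _ _ _ => IsLeastWitness.unique]
  exact forall_congr' fun u => IsLeastWitness.exists_iff

/-- The matrix of a `Π⁰₃` definition of the least witnesses for the predicates
`fun x y => ∃ z, ∀ w, R e x y z w`. -/
def leastWitnessMatrix (R : ℕ → ℕ → ℕ → ℕ → ℕ → Bool) (n : ℕ × List ℕ) (u : ℕ × ℕ)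
    (v : ℕ × ℕ × ℕ) (w : ℕ) : Bool :=
  R n.1 n.2.length u.2 v.2.2 w && (!(decide (u.1 < n.2.length)) ||
    (!(R n.1 u.1 (n.2.getD u.1 0) u.2 v.2.1) &&
      (!(decide (u.2 < n.2.getD u.1 0)) || R n.1 u.1 u.2 v.1 w)))

theorem computable_leastWitnessMatrix {R : ℕ → ℕ → ℕ → ℕ → ℕ → Bool}
    (hR : Computable fun p : ℕ × ℕ × ℕ × ℕ × ℕ =>
      R p.1 p.2.1 p.2.2.1 p.2.2.2.1 p.2.2.2.2) :
    Computable fun q : (ℕ × List ℕ) × (ℕ × ℕ) × (ℕ × ℕ × ℕ) × ℕ =>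
      leastWitnessMatrix R q.1 q.2.1 q.2.2.1 q.2.2.2 := by
  have he : Primrec fun q : (ℕ × List ℕ) × (ℕ × ℕ) × (ℕ × ℕ × ℕ) × ℕ => q.1.1 :=
    Primrec.fst.comp Primrec.fst
  have hk : Primrec fun q : (ℕ × List ℕ) × (ℕ × ℕ) × (ℕ × ℕ × ℕ) × ℕ => q.1.2 :=
    Primrec.snd.comp Primrec.fst
  have hx : Primrec fun q : (ℕ × List ℕ) × (ℕ × ℕ) × (ℕ × ℕ × ℕ) × ℕ => q.2.1.1 :=
    Primrec.fst.comp (Primrec.fst.comp Primrec.snd)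
  have hy : Primrec fun q : (ℕ × List ℕ) × (ℕ × ℕ) × (ℕ × ℕ × ℕ) × ℕ => q.2.1.2 :=
    Primrec.snd.comp (Primrec.fst.comp Primrec.snd)
  have hv : Primrec fun q : (ℕ × List ℕ) × (ℕ × ℕ) × (ℕ × ℕ × ℕ) × ℕ => q.2.2.1 :=
    Primrec.fst.comp (Primrec.snd.comp Primrec.snd)
  have hw : Primrec fun q : (ℕ × List ℕ) × (ℕ × ℕ) × (ℕ × ℕ × ℕ) × ℕ => q.2.2.2 :=
    Primrec.snd.comp (Primrec.snd.comp Primrec.snd)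
  have hm : Primrec fun q : (ℕ × List ℕ) × (ℕ × ℕ) × (ℕ × ℕ × ℕ) × ℕ =>
      q.1.2.getD q.2.1.1 0 := (Primrec.list_getD 0).comp hk hx
  have hlen := Primrec.list_length.comp hk
  have hRc {x y z w : (ℕ × List ℕ) × (ℕ × ℕ) × (ℕ × ℕ × ℕ) × ℕ → ℕ} (hx : Primrec x)
      (hy : Primrec y) (hz : Primrec z) (hw : Primrec w) :
      Computable fun q => R q.1.1 (x q) (y q) (z q) (w q) :=
    hR.comp (he.pair (hx.pair (hy.pair (hz.pair hw)))).to_comp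
  have hlt {x y : (ℕ × List ℕ) × (ℕ × ℕ) × (ℕ × ℕ × ℕ) × ℕ → ℕ} (hx : Primrec x)
      (hy : Primrec y) : Computable fun q => decide (x q < y q) :=
    (Primrec.nat_lt.comp hx hy).decide.to_comp
  exact computable_and
    (hRc hlen hy (Primrec.snd.comp (Primrec.snd.comp hv)) hw)
    (computable_or (computable_not (hlt hx hlen))
      (computable_and
        (computable_not (hRc hx hm hy (Primrec.fst.comp (Primrec.snd.comp hv))))
        (computable_or (computable_not (hlt hy hm))
          (hRc hx hy (Primrec.fst.comp hv) hw))))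

theorem isLeastWitness_iff_leastWitnessMatrix (R : ℕ → ℕ → ℕ → ℕ → ℕ → Bool) (e : ℕ)
    (k : List ℕ) :
    IsLeastWitness (fun x y => ∃ z, ∀ w, R e x y z w = true) k ↔
      ∀ u, ∃ v, ∀ w, leastWitnessMatrix R (e, k) u v w = true := by
  symm
  constructor
  · refine fun h => ⟨fun x m hm => ?_, fun y => ?_⟩
    · obtain ⟨hx, rfl⟩ := List.getElem?_eq_some_iff.1 hm
      refine ⟨fun y hy => ?_, ?_⟩
      · obtain ⟨v, hv⟩ := h (x, y)
        refine ⟨v.1, fun w => ?_⟩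
        have := hv w
        simp_all [leastWitnessMatrix]
      · rintro ⟨z, hz⟩
        obtain ⟨v, hv⟩ := h (x, z)
        have := hv 0
        simp_all [leastWitnessMatrix]
    · obtain ⟨v, hv⟩ := h (0, y)
      refine ⟨v.2.2, fun w => ?_⟩
      have := hv w
      simp_all [leastWitnessMatrix]
  · rintro ⟨hsel, hall⟩ ⟨x, y⟩
    obtain ⟨z, hz⟩ := hall y
    by_cases hx : x < k.length
    · obtain ⟨h₁, h₂⟩ := hsel x _ (List.getElem?_eq_getElem hx)
      push Not at h₂
      obtain ⟨w', hw'⟩ := h₂ y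
      by_cases hy : y < k[x]
      · obtain ⟨z', hz'⟩ := h₁ y hy
        exact ⟨(z', w', z), fun w => by simp_all [leastWitnessMatrix]⟩
      · exact ⟨(0, w', z), fun w => by simp_all [leastWitnessMatrix]⟩
    · exact ⟨(0, 0, z), fun w => by simp_all [leastWitnessMatrix]⟩

/-- For each Σ⁰₄ set `Q` there is a computable `g` with: `e ∈ Q` gives exactly
one `x` with `g e x ∈ COINF`, and `e ∉ Q` gives `g e x ∈ COF` for all `x`. -/
theorem sigma4_unique_coinf_reduction (Q : Set ℕ) (hQ : IsSigma4 Q) :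
    ∃ g : ℕ → ℕ → ℕ, Computable₂ g ∧
      ∀ e, (e ∈ Q → ∃! x, g e x ∈ COINF) ∧ (e ∉ Q → ∀ x, g e x ∈ COF) := by
  obtain ⟨R, hR, hRQ⟩ := hQ
  have hdec : Computable fun q : (ℕ × List ℕ) × ℕ × ℕ × ℕ =>
      (q.1, Denumerable.ofNat (ℕ × ℕ) q.2.1, Denumerable.ofNat (ℕ × ℕ × ℕ) q.2.2.1, q.2.2.2) :=
    Computable.fst.pair
      ((computable_ofNat_prod.comp (Computable.fst.comp Computable.snd)).pair
        ((computable_ofNat_triple.comp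
          (Computable.fst.comp (Computable.snd.comp Computable.snd))).pair
            (Computable.snd.comp (Computable.snd.comp Computable.snd))))
  have hT := (computable_leastWitnessMatrix hR).comp hdec
  obtain ⟨f, hf, hfT⟩ := exists_computable_mem_COINF_iff
    (T := fun n u v w => leastWitnessMatrix R n (Denumerable.ofNat (ℕ × ℕ) u)
      (Denumerable.ofNat (ℕ × ℕ × ℕ) v) w) hT
  have hwit (e : ℕ) (k : List ℕ) : f (e, k) ∈ COINF ↔
      IsLeastWitness (fun x y => ∃ z, ∀ w, R e x y z w = true) k := by
    have hdecode : f (e, k) ∈ COINF ↔ ∀ u, ∃ v, ∀ w, leastWitnessMatrix R (e, k) u v w = true := by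
      rw [hfT]
      constructor
      · intro h u
        obtain ⟨v, hv⟩ := h (Encodable.encode u)
        rw [Denumerable.ofNat_encode] at hv
        exact ⟨_, hv⟩
      · intro h u
        obtain ⟨v, hv⟩ := h (Denumerable.ofNat (ℕ × ℕ) u)
        exact ⟨Encodable.encode v, by rwa [Denumerable.ofNat_encode]⟩
    rw [hdecode, isLeastWitness_iff_leastWitnessMatrix]
  refine ⟨fun e x => f (e, Denumerable.ofNat (List ℕ) x), ?_, fun e => ⟨fun he => ?_, ?_⟩⟩
  · exact hf.comp (Computable.fst.pair (computable_ofNat_list.comp Computable.snd))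
  · obtain ⟨k, hk⟩ := IsLeastWitness.exists_iff.2 ((hRQ e).1 he)
    refine ⟨Encodable.encode k, by simpa [hwit] using hk, fun x hx => ?_⟩
    rw [← ((hwit e _).1 hx).unique hk, Denumerable.encode_ofNat]
  · intro he x
    exact Set.not_infinite.1 fun hx =>
      he ((hRQ e).2 (IsLeastWitness.exists_iff.1 ⟨_, (hwit e _).1 hx⟩))
end

section
/- For every Σ⁰₄ set P there is a one-to-one computable function r : ℕ × ℕ → ℕ such that e ∈ P if and only if there exists y with r(e,y) ∈ COINF; moreover, if e ∈ P then r(e,y) ∈ COINF for all but finitely many y, and if e ∉ P then r(e,y) ∈ COF for every y. -/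
/-- The deficiency stages of `h`: those whose value is later matched or undercut. -/
def deficiencySet (h : ℕ → ℕ) : Set ℕ := {s | ∃ t, s < t ∧ h t ≤ h s}

theorem infinite_compl_deficiencySet_iff (h : ℕ → ℕ) :
    (deficiencySet h)ᶜ.Infinite ↔ ∀ y, {s | h s = y}.Finite := by
  constructor
  · intro hinf y
    by_contra hy
    refine hinf (Set.Finite.of_injOn (t := Set.Iio y) (f := h) ?_ ?_ (Set.finite_Iio y))
    · intro s hs
      obtain ⟨t, ht, hst⟩ := Set.Infinite.exists_gt hy s
      by_contra hlt
      exact hs ⟨t, hst, by simp only [Set.mem_ofPred_eq, Set.mem_Iio] at *; omega⟩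
    · intro s hs t ht hst
      rcases lt_trichotomy s t with hlt | heq | hlt
      · exact absurd ⟨t, hlt, hst.ge⟩ hs
      · exact heq
      · exact absurd ⟨s, hlt, hst.le⟩ ht
  · intro hfin
    refine Set.infinite_of_not_bddAbove ?_
    rintro ⟨N, hN⟩
    have hne : ∃ y, ∃ s, N < s ∧ h s = y := ⟨_, N + 1, by omega, rfl⟩
    classical
    obtain ⟨s₀, hs₀, hm⟩ := Nat.find_spec hne
    obtain ⟨s, hs, hmax⟩ := Set.Finite.exists_maximal (hfin (Nat.find hne)) ⟨s₀, hm⟩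
    have hs₀s : s₀ ≤ s := by
      rcases le_total s₀ s with hle | hle
      · exact hle
      · exact hmax hm hle
    refine absurd (hN (a := s) ?_) (by omega)
    rintro ⟨t, hst, hts⟩
    have hmin : Nat.find hne ≤ h t := Nat.find_min' hne ⟨t, by omega, rfl⟩
    have hs' : h s = Nat.find hne := hs
    have : t ≤ s := hmax (show h t = Nat.find hne by omega) hst.le
    omega

open Classical in
/-- Stage `⟨y, ⟨z, k⟩⟩` takes the value `y` when `k + 1` is the first stage at which all of
`A y 0, …, A y z` hold; every other stage takes itself as value. -/
noncomputable def completionValue (A : ℕ → ℕ → ℕ → Prop) (s : ℕ) : ℕ :=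
  if (∀ z < s.unpair.2.unpair.1 + 1, A s.unpair.1 z (s.unpair.2.unpair.2 + 1)) ∧
      ¬ ∀ z < s.unpair.2.unpair.1 + 1, A s.unpair.1 z s.unpair.2.unpair.2
  then s.unpair.1 else s

theorem forall_finite_completionValue_iff {A : ℕ → ℕ → ℕ → Prop}
    (hmono : ∀ y z k l, k ≤ l → A y z k → A y z l) (hzero : ∀ y z, ¬ A y z 0) :
    (∀ y, {s | completionValue A s = y}.Finite) ↔ ∀ y, ∃ z, ∀ k, ¬ A y z k := by
  refine forall_congr' fun y => ⟨fun hfin => ?_, ?_⟩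
  · by_contra! hA
    have hall : ∀ z, ∃ k, (∀ z' < z + 1, A y z' (k + 1)) ∧ ¬ ∀ z' < z + 1, A y z' k := by
      intro z
      choose g hg using hA
      have hex : ∃ k, ∀ z' < z + 1, A y z' k :=
        ⟨(Finset.range (z + 1)).sup g, fun z' hz' =>
          hmono _ _ _ _ (Finset.le_sup (Finset.mem_range.2 hz')) (hg z')⟩
      classical
      have hpos : Nat.find hex ≠ 0 := fun h0 =>
        hzero y 0 (h0 ▸ Nat.find_spec hex 0 (by omega))
      obtain ⟨k, hk⟩ := Nat.exists_eq_succ_of_ne_zero hpos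
      have hspec := Nat.find_spec hex
      rw [hk] at hspec
      exact ⟨k, hspec, Nat.find_min hex (by omega)⟩
    choose k hk using hall
    refine Set.infinite_of_injective_forall_mem (f := fun z => Nat.pair y (Nat.pair z (k z)))
      ?_ ?_ hfin
    · intro z z' hzz
      simp only [Nat.pair_eq_pair] at hzz
      exact hzz.2.1
    · intro z
      simp only [Set.mem_ofPred_eq]
      unfold completionValue
      rw [if_pos (by simpa only [Nat.unpair_pair] using hk z), Nat.unpair_pair]
  · rintro ⟨z₀, hz₀⟩
    refine ((Set.finite_singleton y).union (Set.Finite.of_injOn (t := Set.Iio z₀)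
      (s := {s | completionValue A s = y ∧ s ≠ y})
      (f := fun s => s.unpair.2.unpair.1) ?_ ?_ (Set.finite_Iio z₀))).subset ?_
    · rintro s ⟨hs, hsy⟩
      unfold completionValue at hs
      split_ifs at hs with hc
      · by_contra hlt
        simp only [Set.mem_Iio] at hlt
        exact hz₀ _ (hs ▸ hc.1 z₀ (by omega))
      · exact absurd hs hsy
    · rintro s ⟨hs, hsy⟩ t ⟨ht, hty⟩ hst
      unfold completionValue at hs ht
      split_ifs at hs with hc
      · split_ifs at ht with hd
        · simp only at hst
          rw [hs] at hc
          rw [ht, ← hst] at hd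
          have hk : s.unpair.2.unpair.2 = t.unpair.2.unpair.2 := by
            rcases lt_trichotomy s.unpair.2.unpair.2 t.unpair.2.unpair.2 with hlt | heq | hlt
            · exact absurd (fun z hz => hmono _ _ _ _ hlt (hc.1 z hz)) hd.2
            · exact heq
            · exact absurd (fun z hz => hmono _ _ _ _ hlt (hd.1 z hz)) hc.2
          rw [← Nat.pair_unpair s, ← Nat.pair_unpair t, hs, ht, ← Nat.pair_unpair s.unpair.2,
            ← Nat.pair_unpair t.unpair.2, hst, hk]
        · exact absurd ht hty
      · exact absurd hs hsy
    · intro s hs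
      by_cases hsy : s = y
      · exact Or.inl hsy
      · exact Or.inr ⟨hs, hsy⟩

/-- The projection of a computable relation is computably enumerable. -/
theorem ComputablePred.rePred_exists {α : Type*} [Primcodable α] {p : α → ℕ → Prop}
    (hp : ComputablePred fun a : α × ℕ => p a.1 a.2) : REPred fun a => ∃ n, p a n := by
  obtain ⟨_, hdec⟩ := hp
  have hrf : Partrec fun a : α => Nat.rfind fun n =>
      (Part.some (decide (p (a, n).1 (a, n).2)) : Part Bool) := Partrec.rfind hdec.partrec
  refine hrf.dom_re.of_eq fun a => ?_
  exact Nat.rfind_dom.trans (by simp)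

/-- A computably enumerable predicate is the union of an increasing sequence of uniformly
primitive recursive ones, the first of which is empty. -/
theorem REPred.exists_primrec_approx {α : Type*} [Primcodable α] {p : α → Prop} (hp : REPred p) :
    ∃ A : α → ℕ → Prop, PrimrecRel A ∧ (∀ a k l, k ≤ l → A a k → A a l) ∧ (∀ a, ¬ A a 0) ∧
      ∀ a, p a ↔ ∃ k, A a k := by
  obtain ⟨c, hc⟩ := Nat.Partrec.Code.exists_code.1 hp
  have hmem : ∀ a, p a ↔ (c.eval (Encodable.encode a)).Dom := by
    intro a
    simp [hc, Part.assert, Part.bind]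
  refine ⟨fun a k => (c.evaln k (Encodable.encode a)).isSome = true, ?_, ?_, ?_, ?_⟩
  · exact ⟨inferInstance, by
      simpa using Primrec.option_isSome.comp (Nat.Partrec.Code.primrec_evaln.comp
        (((Primrec.snd (α := α) (β := ℕ)).pair (Primrec.const c)).pair
          (Primrec.encode.comp Primrec.fst)))⟩
  · intro a k l hkl hk
    obtain ⟨x, hx⟩ := Option.isSome_iff_exists.1 hk
    exact Option.isSome_iff_exists.2 ⟨x, Nat.Partrec.Code.evaln_mono hkl hx⟩
  · intro a
    simp [Nat.Partrec.Code.evaln]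
  · intro a
    simp only [hmem, Part.dom_iff_mem, Nat.Partrec.Code.evaln_complete, Option.isSome_iff_exists,
      Option.mem_def]
    exact exists_comm

theorem PrimrecRel.forall_lt_param {β : Type*} [Primcodable β] {R : ℕ → β → Prop}
    (hR : PrimrecRel R) : PrimrecRel fun n b => ∀ x < n, R x b :=
  PrimrecPred.of_eq (hR.forall_mem_list.comp (Primrec.list_range.comp Primrec.fst) Primrec.snd)
    (by simp)

theorem PrimrecRel.exists_lt_param {β : Type*} [Primcodable β] {R : ℕ → β → Prop}
    (hR : PrimrecRel R) : PrimrecRel fun n b => ∃ x < n, R x b :=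
  PrimrecPred.of_eq (hR.exists_mem_list.comp (Primrec.list_range.comp Primrec.fst) Primrec.snd)
    (by simp)

theorem primrec_completionValue {α : Type*} [Primcodable α] {A : α → ℕ → ℕ → ℕ → Prop}
    (hA : PrimrecPred fun p : α × ℕ × ℕ × ℕ => A p.1 p.2.1 p.2.2.1 p.2.2.2) :
    Primrec₂ fun a s => completionValue (A a) s := by
  have hB : PrimrecRel fun (n : ℕ) (q : α × ℕ × ℕ) => ∀ z < n, A q.1 q.2.1 z q.2.2 := by
    refine PrimrecRel.forall_lt_param (R := fun z (q : α × ℕ × ℕ) => A q.1 q.2.1 z q.2.2) ?_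
    exact hA.comp (f := fun p : ℕ × α × ℕ × ℕ => (p.2.1, p.2.2.1, p.1, p.2.2.2)) (by
      refine .pair (.comp .fst .snd) (.pair (.comp .fst (.comp .snd .snd)) (.pair .fst ?_))
      exact .comp .snd (.comp .snd .snd))
  have hy : Primrec fun p : α × ℕ => p.2.unpair.1 := .comp .fst (Primrec.unpair.comp .snd)
  have hzk : Primrec fun p : α × ℕ => p.2.unpair.2.unpair :=
    Primrec.unpair.comp (.comp .snd (Primrec.unpair.comp .snd))
  have hz : Primrec fun p : α × ℕ => p.2.unpair.2.unpair.1 + 1 :=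
    Primrec.succ.comp (Primrec.fst.comp hzk)
  have hk : Primrec fun p : α × ℕ => p.2.unpair.2.unpair.2 := Primrec.snd.comp hzk
  classical
  exact Primrec.ite
    ((hB.comp hz (.pair .fst (.pair hy (Primrec.succ.comp hk)))).and
      (hB.comp hz (.pair .fst (.pair hy hk))).not) hy .snd

/-- A computably enumerable relation is enumerated by uniform indices, without repetition. -/
theorem REPred.exists_injective_index {p : ℕ × ℕ → ℕ → Prop}
    (hp : REPred fun q : (ℕ × ℕ) × ℕ => p q.1 q.2) :
    ∃ r : ℕ → ℕ → ℕ, Computable₂ r ∧ Function.Injective (fun q : ℕ × ℕ => r q.1 q.2) ∧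
      ∀ e n, Wset (r e n) = {s | p (e, n) s} := by
  obtain ⟨c, hc⟩ := Nat.Partrec.Code.exists_code.1 hp
  refine ⟨fun e n => Encodable.encode (c.curry (Nat.pair e n)), ?_, ?_, ?_⟩
  · exact (Primrec.encode.comp (Nat.Partrec.Code.primrec₂_curry.comp (Primrec.const c)
      (Primrec₂.natPair.comp Primrec.fst Primrec.snd))).to_comp
  · rintro ⟨e, n⟩ ⟨e', n'⟩ h
    have := (Nat.Partrec.Code.curry_inj (Encodable.encode_injective h)).2
    simpa [Nat.pair_eq_pair] using this
  · intro e n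
    ext s
    simp only [Wset, Denumerable.ofNat_encode, Nat.Partrec.Code.eval_curry, hc]
    simp [Part.assert, Part.bind]

theorem rePred_forall_mem_deficiencySet {h : ℕ × ℕ → ℕ → ℕ} (hh : Primrec₂ h) :
    REPred fun q : (ℕ × ℕ) × ℕ => ∀ x < q.1.2 + 1, q.2 ∈ deficiencySet (h (q.1.1, x)) := by
  have hS : PrimrecRel fun (u : ℕ) (v : (ℕ × ℕ) × ℕ) =>
      ∃ t < u, v.2 < t ∧ h v.1 t ≤ h v.1 v.2 := by
    refine PrimrecRel.exists_lt_param
      (R := fun t (v : (ℕ × ℕ) × ℕ) => v.2 < t ∧ h v.1 t ≤ h v.1 v.2) ?_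
    exact (Primrec.nat_lt.comp (.comp .snd .snd) .fst).and
      (Primrec.nat_le.comp (hh.comp (.comp .fst .snd) .fst)
        (hh.comp (.comp .fst .snd) (.comp .snd .snd)))
  have hT : PrimrecRel fun (m : ℕ) (w : (ℕ × ℕ) × ℕ) =>
      ∀ x < m, ∃ t < w.2, w.1.2 < t ∧ h (w.1.1, x) t ≤ h (w.1.1, x) w.1.2 := by
    refine PrimrecRel.forall_lt_param (R := fun x (w : (ℕ × ℕ) × ℕ) =>
      ∃ t < w.2, w.1.2 < t ∧ h (w.1.1, x) t ≤ h (w.1.1, x) w.1.2) ?_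
    exact hS.comp (.comp .snd .snd)
      (g := fun p : ℕ × (ℕ × ℕ) × ℕ => ((p.2.1.1, p.1), p.2.1.2))
      (.pair (.pair (.comp .fst (.comp .fst .snd)) .fst) (.comp .snd (.comp .fst .snd)))
  have hU : PrimrecPred fun a : ((ℕ × ℕ) × ℕ) × ℕ => ∀ x < a.1.1.2 + 1, ∃ t < a.2,
      a.1.2 < t ∧ h (a.1.1.1, x) t ≤ h (a.1.1.1, x) a.1.2 :=
    hT.comp (g := fun a : ((ℕ × ℕ) × ℕ) × ℕ => ((a.1.1.1, a.1.2), a.2))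
      (Primrec.succ.comp (.comp .snd (.comp .fst .fst)))
      (.pair (.pair (.comp .fst (.comp .fst .fst)) (.comp .snd .fst)) .snd)
  obtain ⟨hdec, hprim⟩ := hU
  refine (ComputablePred.rePred_exists (p := fun (q : (ℕ × ℕ) × ℕ) u => ∀ x < q.1.2 + 1,
    ∃ t < u, q.2 < t ∧ h (q.1.1, x) t ≤ h (q.1.1, x) q.2) ⟨hdec, hprim.to_comp⟩).of_eq ?_
  rintro ⟨⟨e, n⟩, s⟩
  constructor
  · rintro ⟨u, hu⟩ x hx
    obtain ⟨t, -, ht⟩ := hu x hx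
    exact ⟨t, ht⟩
  · intro hd
    choose! g hg using hd
    exact ⟨(Finset.range (n + 1)).sup g + 1, fun x hx =>
      ⟨g x, Nat.lt_succ_of_le (Finset.le_sup (Finset.mem_range.2 hx)), hg x hx⟩⟩

/-- Every `Π⁰₃` predicate is uniformly reducible to the infinitude of the set of nondeficiency
stages of a primitive recursive function. -/
theorem exists_primrec_infinite_compl_deficiencySet_iff {α : Type*} [Primcodable α]
    {R : α → ℕ → ℕ → ℕ → Bool}
    (hR : Computable fun p : (α × ℕ × ℕ) × ℕ => R p.1.1 p.1.2.1 p.1.2.2 p.2) :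
    ∃ h : α → ℕ → ℕ, Primrec₂ h ∧ ∀ i,
      (deficiencySet (h i))ᶜ.Infinite ↔ ∀ y, ∃ z, ∀ w, R i y z w = true := by
  have hre : REPred fun p : α × ℕ × ℕ => ∃ w, ¬ R p.1 p.2.1 p.2.2 w = true :=
    ComputablePred.rePred_exists
      (p := fun (p : α × ℕ × ℕ) w => ¬ R p.1 p.2.1 p.2.2 w = true)
      (ComputablePred.not (ComputablePred.computable_iff.2 ⟨_, hR, rfl⟩))
  obtain ⟨A, hA, hmono, hzero, hRA⟩ := hre.exists_primrec_approx
  have hA' : PrimrecPred fun p : α × ℕ × ℕ × ℕ => A (p.1, p.2.1, p.2.2.1) p.2.2.2 :=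
    hA.comp (g := fun p : α × ℕ × ℕ × ℕ => p.2.2.2)
      (f := fun p : α × ℕ × ℕ × ℕ => (p.1, p.2.1, p.2.2.1))
      (.pair .fst (.pair (.comp .fst .snd) (.comp .fst (.comp .snd .snd))))
      (.comp .snd (.comp .snd .snd))
  refine ⟨_, primrec_completionValue (A := fun i y z k => A (i, y, z) k) hA', fun i => ?_⟩
  rw [infinite_compl_deficiencySet_iff, forall_finite_completionValue_iff
    (fun y z => hmono _) (fun y z => hzero _)]
  refine forall_congr' fun y => exists_congr fun z => ?_
  rw [← not_exists, ← hRA (i, y, z)]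
  simp


/-- For each Σ⁰₄ set `P` there is a one-to-one computable `r` reducing `P` to
`∃ y, r e y ∈ COINF`, with cofinitely many witnesses on positive instances and
none on negative ones. -/
theorem sigma4_coinf_reduction (P : Set ℕ) (hP : IsSigma4 P) :
    ∃ r : ℕ → ℕ → ℕ, Computable₂ r ∧
      Function.Injective (fun p : ℕ × ℕ => r p.1 p.2) ∧
      (∀ e, e ∈ P ↔ ∃ y, r e y ∈ COINF) ∧
      (∀ e, e ∈ P → ∃ N, ∀ y ≥ N, r e y ∈ COINF) ∧
      (∀ e, e ∉ P → ∀ y, r e y ∈ COF) := by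
  obtain ⟨R, hR, hPR⟩ := hP
  have hproj : Primrec fun a : ((ℕ × ℕ) × ℕ × ℕ) × ℕ =>
      (a.1.1.1, a.1.1.2, a.1.2.1, a.1.2.2, a.2) :=
    (Primrec.fst.comp (Primrec.fst.comp Primrec.fst)).pair
      ((Primrec.snd.comp (Primrec.fst.comp Primrec.fst)).pair
        ((Primrec.fst.comp (Primrec.snd.comp Primrec.fst)).pair
          ((Primrec.snd.comp (Primrec.snd.comp Primrec.fst)).pair Primrec.snd)))
  have hcomp : Computable fun a : ((ℕ × ℕ) × ℕ × ℕ) × ℕ =>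
      R a.1.1.1 a.1.1.2 a.1.2.1 a.1.2.2 a.2 :=
    (hR.comp hproj.to_comp).of_eq fun _ => rfl
  obtain ⟨h, hh, hcoinf⟩ := exists_primrec_infinite_compl_deficiencySet_iff
    (R := fun i : ℕ × ℕ => R i.1 i.2) hcomp
  obtain ⟨r, hr, hinj, hW⟩ := (rePred_forall_mem_deficiencySet hh).exists_injective_index
    (p := fun i s => ∀ x < i.2 + 1, s ∈ deficiencySet (h (i.1, x)))
  have hmem : ∀ e n, r e n ∈ COINF ↔ ∃ x < n + 1, ∀ y, ∃ z, ∀ w, R e x y z w = true := by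
    intro e n
    have hcompl : (Wset (r e n))ᶜ =
        ⋃ x ∈ Set.Iio (n + 1), (deficiencySet (h (e, x)))ᶜ := by
      ext s
      simp [hW]
    change (Wset (r e n))ᶜ.Infinite ↔ _
    simp only [← hcoinf (e, _)]
    rw [hcompl]
    constructor
    · intro hinf
      by_contra! hfin
      exact hinf ((Set.finite_Iio _).biUnion hfin)
    · rintro ⟨x, hx, hinf⟩
      exact hinf.mono (Set.subset_biUnion_of_mem (u := fun x => (deficiencySet (h (e, x)))ᶜ) hx)
  have hpos : ∀ e, e ∈ P → ∃ N, ∀ y ≥ N, r e y ∈ COINF := by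
    intro e he
    obtain ⟨x, hx⟩ := (hPR e).1 he
    exact ⟨x, fun n hn => (hmem e n).2 ⟨x, Nat.lt_succ_of_le hn, hx⟩⟩
  have hneg : ∀ e n, r e n ∈ COINF → e ∈ P := by
    intro e n hn
    obtain ⟨x, -, hx⟩ := (hmem e n).1 hn
    exact (hPR e).2 ⟨x, hx⟩
  refine ⟨r, hr, hinj, fun e => ⟨fun he => ?_, fun ⟨n, hn⟩ => hneg e n hn⟩, hpos, ?_⟩
  · obtain ⟨N, hN⟩ := hpos e he
    exact ⟨N, hN N le_rfl⟩
  · intro e he n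
    exact Set.not_infinite.1 fun hinf => he (hneg e n hinf)
end

section
/- For every Σ⁰₅ set P there is a computable function f : ℕ × ℕ × ℕ → ℕ such that: if e ∈ P, then there exists x such that f(e,x',y) ∈ COF for all x' > x and all y, and for each x' ≤ x there is at most one y with f(e,x',y) ∈ COINF; and if e ∉ P, then for every x there is exactly one y with f(e,x,y) ∈ COINF. -/
/-- `PiPred k p` says that the predicate `p` on `ℕ` is `Π⁰ₖ`, with `Π⁰₀` the decidable
predicates. -/
def PiPred : ℕ → (ℕ → Prop) → Prop
  | 0, p => ∃ b : ℕ → Bool, Computable b ∧ ∀ n, p n ↔ b n = true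
  | k + 1, p => ∃ q, PiPred k q ∧ ∀ n, p n ↔ ∀ m, ¬ q (Nat.pair n m)

/-- The `i`-th entry of the list coded by `Y` (and `0` past its end). -/
def listEntry (Y i : ℕ) : ℕ := (Denumerable.ofNat (List ℕ) Y).getD i 0

/-- The length of the list coded by `Y`. -/
def listLength (Y : ℕ) : ℕ := (Denumerable.ofNat (List ℕ) Y).length

theorem computable_unpair_fst : Computable fun n : ℕ => n.unpair.1 :=
  (Primrec.fst.comp Primrec.unpair).to_comp

theorem computable_unpair_snd : Computable fun n : ℕ => n.unpair.2 :=
  (Primrec.snd.comp Primrec.unpair).to_comp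

theorem computable_pair {α : Type*} [Primcodable α] {f g : α → ℕ} (hf : Computable f)
    (hg : Computable g) : Computable fun a => Nat.pair (f a) (g a) :=
  Primrec₂.natPair.to_comp.comp hf hg

theorem computable_listEntry {α : Type*} [Primcodable α] {f g : α → ℕ} (hf : Computable f)
    (hg : Computable g) : Computable fun a => listEntry (f a) (g a) :=
  (Primrec.list_getD 0).to_comp.comp ((Primrec.ofNat (List ℕ)).to_comp.comp hf) hg

theorem computable_listLength {α : Type*} [Primcodable α] {f : α → ℕ} (hf : Computable f) :
    Computable fun a => listLength (f a) :=
  (Primrec.list_length.comp (Primrec.ofNat (List ℕ))).to_comp.comp hf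

theorem computable_decide_lt {α : Type*} [Primcodable α] {f g : α → ℕ} (hf : Computable f)
    (hg : Computable g) : Computable fun a => decide (f a < g a) :=
  (Primrec.nat_lt.decide).to_comp.comp hf hg

theorem computable_decide_eq {α : Type*} [Primcodable α] {f g : α → ℕ} (hf : Computable f)
    (hg : Computable g) : Computable fun a => decide (f a = g a) :=
  (Primrec.eq.decide (α := ℕ)).to_comp.comp hf hg

theorem exists_list_choice (m : ℕ) (p : ℕ → ℕ → Prop) (h : ∀ i < m, ∃ c, p i c) :
    ∃ Y, listLength Y = m ∧ ∀ i < m, p i (listEntry Y i) := by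
  classical
  choose! c hc using h
  refine ⟨Encodable.encode ((List.range m).map c), ?_, fun i hi => ?_⟩
  · simp [listLength]
  · simpa [listEntry, hi] using hc i hi

theorem list_code_ext {Y Y' : ℕ} (hl : listLength Y = listLength Y')
    (h : ∀ i < listLength Y, listEntry Y i = listEntry Y' i) : Y = Y' := by
  have : Denumerable.ofNat (List ℕ) Y = Denumerable.ofNat (List ℕ) Y' := by
    refine List.ext_getElem hl fun i h₁ h₂ => ?_
    simpa [listEntry, h₁, h₂] using h i h₁
  simpa using congrArg Encodable.encode this

namespace PiPred

theorem congr {k : ℕ} {p p' : ℕ → Prop} (hp : PiPred k p) (h : ∀ n, p' n ↔ p n) :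
    PiPred k p' := by
  rwa [funext fun n => propext (h n)]

theorem comp {k : ℕ} {p : ℕ → Prop} (hp : PiPred k p) {g : ℕ → ℕ} (hg : Computable g) :
    PiPred k fun n => p (g n) := by
  induction k generalizing p g with
  | zero =>
    obtain ⟨b, hb, h⟩ := hp
    exact ⟨_, hb.comp hg, fun n => h _⟩
  | succ k ih =>
    obtain ⟨q, hq, h⟩ := hp
    refine ⟨_, ih hq (computable_pair (hg.comp computable_unpair_fst) computable_unpair_snd),
      fun n => ?_⟩
    simp [h]

theorem const (k : ℕ) (P : Prop) : PiPred k fun _ => P := by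
  classical
  induction k generalizing P with
  | zero => exact ⟨fun _ => decide P, Computable.const _, by simp⟩
  | succ k ih => exact ⟨_, ih (¬ P), by simp⟩

theorem ite {k : ℕ} {p p' : ℕ → Prop} (hp : PiPred k p) (hp' : PiPred k p') {c : ℕ → Bool}
    (hc : Computable c) : PiPred k fun n => if c n = true then p n else p' n := by
  induction k generalizing p p' c with
  | zero =>
    obtain ⟨b, hb, h⟩ := hp
    obtain ⟨b', hb', h'⟩ := hp'
    refine ⟨fun n => cond (c n) (b n) (b' n), Computable.cond hc hb hb', fun n => ?_⟩
    cases hcn : c n <;> simp [h, h', hcn]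
  | succ k ih =>
    obtain ⟨q, hq, h⟩ := hp
    obtain ⟨q', hq', h'⟩ := hp'
    refine ⟨_, ih hq hq' (hc.comp computable_unpair_fst), fun n => ?_⟩
    cases hcn : c n <;> simp [h, h', hcn]

theorem imp {k : ℕ} {p : ℕ → Prop} (hp : PiPred k p) {c : ℕ → Bool} (hc : Computable c) :
    PiPred k fun n => c n = true → p n := by
  refine (hp.ite (const k True) hc).congr fun n => ?_
  cases c n <;> simp

theorem succ {k : ℕ} {p : ℕ → Prop} (hp : PiPred k p) : PiPred (k + 1) p := by
  induction k generalizing p with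
  | zero =>
    obtain ⟨b, hb, h⟩ := hp
    refine ⟨fun u => (!b u.unpair.1) = true,
      ⟨_, Primrec.not.to_comp.comp (hb.comp computable_unpair_fst), fun _ => Iff.rfl⟩,
      fun n => ?_⟩
    simp [h]
  | succ k ih =>
    obtain ⟨q, hq, h⟩ := hp
    exact ⟨q, ih hq, h⟩

theorem all {k : ℕ} {p : ℕ → Prop} (hp : PiPred (k + 1) p) :
    PiPred (k + 1) fun n => ∀ m, p (Nat.pair n m) := by
  obtain ⟨q, hq, h⟩ := hp
  refine ⟨_, hq.comp (g := fun u => Nat.pair (Nat.pair u.unpair.1 u.unpair.2.unpair.1)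
      u.unpair.2.unpair.2)
    (computable_pair (computable_pair computable_unpair_fst
      (computable_unpair_fst.comp computable_unpair_snd))
      (computable_unpair_snd.comp computable_unpair_snd)), fun n => ?_⟩
  simp only [h, Nat.unpair_pair]
  exact ⟨fun H m => H _ _, fun H m l => by simpa using H (Nat.pair m l)⟩

theorem and {k : ℕ} {p p' : ℕ → Prop} (hp : PiPred k p) (hp' : PiPred k p') :
    PiPred k fun n => p n ∧ p' n := by
  cases k with
  | zero =>
    obtain ⟨b, hb, h⟩ := hp
    obtain ⟨b', hb', h'⟩ := hp'
    exact ⟨_, Primrec.and.to_comp.comp hb hb', fun n => by simp [h, h']⟩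
  | succ k =>
    refine ((hp.comp computable_unpair_fst).ite (hp'.comp computable_unpair_fst)
      (computable_decide_eq computable_unpair_snd (Computable.const 0))).all.congr fun n => ?_
    simp only [Nat.unpair_pair, decide_eq_true_eq]
    refine ⟨fun H m => ?_, fun H => ⟨by simpa using H 0, by simpa using H 1⟩⟩
    split_ifs
    exacts [H.1, H.2]

theorem not {p : ℕ → Prop} (hp : PiPred 0 p) : PiPred 0 fun n => ¬ p n := by
  obtain ⟨b, hb, h⟩ := hp
  exact ⟨_, Primrec.not.to_comp.comp hb, fun n => by simp [h]⟩

theorem ball {p : ℕ → Prop} (hp : PiPred 0 p) {g : ℕ → ℕ} (hg : Computable g) :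
    PiPred 0 fun n => ∀ i < g n, p (Nat.pair n i) := by
  obtain ⟨b, hb, h⟩ := hp
  refine ⟨fun n => Nat.rec true (fun i r => r && b (Nat.pair n i)) (g n),
    Computable.nat_rec hg (Computable.const true)
      (Primrec.and.to_comp.comp (Computable.snd.comp Computable.snd)
        (hb.comp (computable_pair Computable.fst (Computable.fst.comp Computable.snd)))).to₂,
    fun n => ?_⟩
  beta_reduce
  generalize g n = N
  induction N with
  | zero => simp
  | succ N ih =>
    rw [Nat.forall_lt_succ_right, ih]
    simp [h]

/-- Every `∃ Π⁰ₖ` predicate is a `∃! Π⁰ₖ` predicate. -/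
theorem exists_unique_witness {k : ℕ} {q : ℕ → Prop} (hq : PiPred k q) :
    ∃ q', PiPred k q' ∧ ∀ n, ((∃ m, q' (Nat.pair n m)) ↔ ∃ m, q (Nat.pair n m)) ∧
      ∀ m m', q' (Nat.pair n m) → q' (Nat.pair n m') → m = m' := by
  classical
  induction k generalizing q with
  | zero =>
    refine ⟨_, hq.and ((hq.not.comp (g := fun u => Nat.pair u.unpair.1.unpair.1 u.unpair.2)
      (computable_pair (computable_unpair_fst.comp computable_unpair_fst)
        computable_unpair_snd)).ball computable_unpair_snd), fun n => ⟨⟨?_, ?_⟩, ?_⟩⟩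
    · rintro ⟨m, hm⟩
      exact ⟨m, hm.1⟩
    · intro H
      exact ⟨Nat.find H, Nat.find_spec H,
        fun i hi => by simpa using Nat.find_min H (by simpa using hi)⟩
    · intro m m' hm hm'
      simp only [Nat.unpair_pair] at hm hm'
      rcases lt_trichotomy m m' with hlt | heq | hlt
      exacts [absurd hm.1 (hm'.2 m hlt), heq, absurd hm'.1 (hm.2 m' hlt)]
  | succ k ih =>
    have hq₀ := hq
    obtain ⟨r, hr, hqr⟩ := hq
    obtain ⟨r', hr', hu⟩ := ih hr
    have hlen : PiPred (k + 1) fun u => listLength u.unpair.2.unpair.2 = u.unpair.2.unpair.1 := by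
      refine ((const (k + 1) True).ite (const (k + 1) False) (computable_decide_eq
        (computable_listLength (computable_unpair_snd.comp computable_unpair_snd))
        (computable_unpair_fst.comp computable_unpair_snd))).congr fun u => ?_
      simp
    have hwit : PiPred (k + 1) fun u => ∀ i, i < u.unpair.2.unpair.1 →
        r' (Nat.pair (Nat.pair u.unpair.1 i) (listEntry u.unpair.2.unpair.2 i)) := by
      have hsnd : Computable fun u : ℕ => u.unpair.1.unpair.2 :=
        computable_unpair_snd.comp computable_unpair_fst
      refine ((hr'.succ.comp (g := fun u => Nat.pair (Nat.pair u.unpair.1.unpair.1 u.unpair.2)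
          (listEntry u.unpair.1.unpair.2.unpair.2 u.unpair.2))
        (computable_pair (computable_pair (computable_unpair_fst.comp computable_unpair_fst)
          computable_unpair_snd) (computable_listEntry (computable_unpair_snd.comp hsnd)
          computable_unpair_snd))).imp (computable_decide_lt computable_unpair_snd
          (computable_unpair_fst.comp hsnd))).all.congr fun u => ?_
      simp
    have hmain := hq₀.comp (g := fun u => Nat.pair u.unpair.1 u.unpair.2.unpair.1)
      (computable_pair computable_unpair_fst (computable_unpair_fst.comp computable_unpair_snd))
    have hnot : ∀ n m, ¬ q (Nat.pair n m) ↔ ∃ l, r' (Nat.pair (Nat.pair n m) l) := by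
      intro n m
      rw [(hu _).1, hqr]
      push Not
      rfl
    refine ⟨_, hmain.and (hlen.and hwit), fun n => ⟨⟨?_, ?_⟩, ?_⟩⟩
    · rintro ⟨m, hm⟩
      simp only [Nat.unpair_pair] at hm
      exact ⟨_, hm.1⟩
    · intro H
      obtain ⟨Y, hY, hYw⟩ := exists_list_choice (Nat.find H)
        (fun i c => r' (Nat.pair (Nat.pair n i) c))
        fun i hi => (hnot n i).1 (Nat.find_min H hi)
      refine ⟨Nat.pair (Nat.find H) Y, ?_⟩
      simp only [Nat.unpair_pair]
      exact ⟨Nat.find_spec H, hY, hYw⟩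
    · intro s s'
      obtain ⟨⟨m, Y⟩, rfl⟩ := Nat.pairEquiv.surjective s
      obtain ⟨⟨m', Y'⟩, rfl⟩ := Nat.pairEquiv.surjective s'
      simp only [Nat.pairEquiv_apply, Function.uncurry_apply_pair, Nat.unpair_pair]
      rintro ⟨hm, hY, hw⟩ ⟨hm', hY', hw'⟩
      have hmm : m = m' := by
        rcases lt_trichotomy m m' with hlt | heq | hlt
        exacts [absurd hm ((hnot n m).2 ⟨_, hw' m hlt⟩), heq,
          absurd hm' ((hnot n m').2 ⟨_, hw m' hlt⟩)]
      subst hmm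
      rw [list_code_ext (hY.trans hY'.symm) fun i hi =>
        (hu _).2 _ _ (hw i (hY ▸ hi)) (hw' i (hY ▸ hi))]

end PiPred

/-- The deficiency set of `h` is cofinite iff `h` takes some value infinitely often. -/
theorem finite_compl_deficiency_iff (h : ℕ → ℕ) :
    ({x | ∃ t, x < t ∧ h t ≤ h x}ᶜ : Set ℕ).Finite ↔ ∃ a, {s | h s = a}.Infinite := by
  constructor
  · intro hfin
    by_contra! hno
    refine hfin.not_infinite (Set.infinite_of_not_bddAbove ?_)
    rintro ⟨B, hB⟩
    have hex : ∃ a s, B < s ∧ h s = a := ⟨_, B + 1, by omega, rfl⟩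
    classical
    obtain ⟨s, hs, hsa⟩ := Nat.find_spec hex
    obtain ⟨x, hx, hmax⟩ := Set.exists_max_image _ id (hno (Nat.find hex)) ⟨s, hsa⟩
    have hsx : s ≤ x := hmax s hsa
    have hxB : x ≤ B := by
      refine hB ?_
      rintro ⟨t, hxt, ht⟩
      have h₁ : Nat.find hex ≤ h t := Nat.find_min' hex ⟨t, by omega, rfl⟩
      have hx' : h x = Nat.find hex := hx
      have h₂ : t ≤ x := hmax t (show h t = _ by omega)
      omega
    omega
  · rintro ⟨a, ha⟩
    refine Set.Finite.of_finite_image (f := h) ((Set.finite_lt_nat a).subset ?_) ?_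
    · rintro _ ⟨x, hx, rfl⟩
      obtain ⟨t, ht, hxt⟩ := ha.exists_gt x
      by_contra hlt
      exact hx ⟨t, hxt, by simp only [Set.mem_ofPred_eq] at ht hlt; omega⟩
    · intro x hx y hy hxy
      rcases lt_trichotomy x y with hlt | heq | hlt
      exacts [absurd ⟨y, hlt, hxy.ge⟩ hx, heq, absurd ⟨x, hlt, hxy.le⟩ hy]

/-- Every computable sequence of functions has a computable sequence of indices for the
deficiency sets. -/
theorem exists_index_deficiency {h : ℕ → ℕ → ℕ} (hh : Computable₂ h) :
    ∃ g : ℕ → ℕ, Computable g ∧ ∀ n, Wset (g n) = {x | ∃ t, x < t ∧ h n t ≤ h n x} := by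
  let test : ℕ → ℕ → Bool := fun u t =>
    decide (u.unpair.2 < t) && !decide (h u.unpair.1 u.unpair.2 < h u.unpair.1 t)
  have htest : Computable₂ test :=
    (Primrec.and.to_comp.comp
      (computable_decide_lt (computable_unpair_snd.comp Computable.fst) Computable.snd)
      (Primrec.not.to_comp.comp (computable_decide_lt
        (hh.comp (computable_unpair_fst.comp Computable.fst)
          (computable_unpair_snd.comp Computable.fst))
        (hh.comp (computable_unpair_fst.comp Computable.fst) Computable.snd)))).to₂
  have hpart : Partrec fun u => Nat.rfind fun t => Part.some (test u t) :=
    Partrec.rfind htest.partrec₂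
  obtain ⟨c, hc⟩ := Nat.Partrec.Code.exists_code.1 (Partrec.nat_iff.1 hpart)
  obtain ⟨s, hs, hsmn⟩ := Nat.Partrec.Code.smn
  refine ⟨fun n => Encodable.encode (s c n),
    Computable.encode.comp (hs.comp (Computable.const c) Computable.id), fun n => ?_⟩
  ext x
  simp only [Wset, Set.mem_ofPred_eq, Denumerable.ofNat_encode, hsmn, hc]
  refine Nat.rfind_dom.trans ?_
  simp [test]

/-- Every `Π⁰₃` predicate is many-one reducible to `COINF`. -/
theorem PiPred.exists_reduction_coinf {p : ℕ → Prop} (hp : PiPred 3 p) :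
    ∃ g : ℕ → ℕ, Computable g ∧ ∀ n, p n ↔ g n ∈ COINF := by
  obtain ⟨q₂, ⟨q₁, ⟨q₀, hq₀, h₁⟩, h₂⟩, h₃⟩ := hp
  obtain ⟨r, hr, hu⟩ := hq₀.exists_unique_witness
  -- `valid ⟨n, ⟨a, L⟩⟩`: the list `L` consists of the witnesses for its indices
  obtain ⟨valid, hvc, hv⟩ := (hr.comp (g := fun u => Nat.pair (Nat.pair (Nat.pair
      u.unpair.1.unpair.1 u.unpair.1.unpair.2.unpair.1) u.unpair.2)
      (listEntry u.unpair.1.unpair.2.unpair.2 u.unpair.2))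
    (computable_pair (computable_pair (computable_pair
      (computable_unpair_fst.comp computable_unpair_fst)
      (computable_unpair_fst.comp (computable_unpair_snd.comp computable_unpair_fst)))
      computable_unpair_snd)
      (computable_listEntry
        (computable_unpair_snd.comp (computable_unpair_snd.comp computable_unpair_fst))
        computable_unpair_snd))).ball
    (computable_listLength (computable_unpair_snd.comp computable_unpair_snd))
  simp only [Nat.unpair_pair] at hv
  let h : ℕ → ℕ → ℕ := fun n s => cond (valid (Nat.pair n s)) s.unpair.1 s
  have hh : Computable₂ h :=
    (Computable.cond (hvc.comp (computable_pair Computable.fst Computable.snd))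
      (computable_unpair_fst.comp Computable.snd) Computable.snd).to₂
  obtain ⟨g, hg, hgW⟩ := exists_index_deficiency hh
  refine ⟨g, hg, fun n => ?_⟩
  have key : ∀ a, {s | h n s = a}.Infinite ↔ q₂ (Nat.pair n a) := by
    intro a
    rw [h₂]
    simp only [h₁, not_forall, not_not]
    simp only [← (hu _).1]
    constructor
    · contrapose!
      rintro ⟨b, hb⟩
      have hlist : {L | valid (Nat.pair n (Nat.pair a L)) = true}.Finite := by
        refine Set.Finite.of_finite_image (f := listLength)
          ((Set.finite_le_nat b).subset ?_) ?_
        · rintro _ ⟨L, hL, rfl⟩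
          by_contra hlt
          have := (hv _).2 hL b (by simpa using hlt)
          simp only [Nat.unpair_pair] at this
          exact hb _ this
        · intro L hL L' hL' hLL
          have e := (hv _).2 hL
          have e' := (hv _).2 hL'
          simp only [Nat.unpair_pair] at e e'
          exact list_code_ext hLL fun i hi => (hu _).2 _ _ (e i hi) (e' i (hLL ▸ hi))
      refine ((hlist.image (Nat.pair a)).insert a).subset fun s hs => ?_
      obtain ⟨⟨a', L⟩, rfl⟩ := Nat.pairEquiv.surjective s
      simp only [Nat.pairEquiv_apply, Function.uncurry_apply_pair, Set.mem_ofPred_eq, h] at hs ⊢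
      cases hval : valid (Nat.pair n (Nat.pair a' L)) with
      | false => exact Or.inl (by simpa [hval] using hs)
      | true =>
        have : a' = a := by simpa [hval] using hs
        subst this
        exact Or.inr ⟨L, hval, rfl⟩
    · intro H
      choose Y hY hYw using fun m => exists_list_choice m
        (fun i c => r (Nat.pair (Nat.pair (Nat.pair n a) i) c)) fun i _ => H i
      have hinj : Function.Injective fun m => Nat.pair a (Y m) := by
        intro m m' hmm
        have : Y m = Y m' := (Nat.pair_eq_pair.1 hmm).2
        rw [← hY m, this, hY]
      refine (Set.infinite_range_of_injective hinj).mono ?_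
      rintro _ ⟨m, rfl⟩
      have : valid (Nat.pair n (Nat.pair a (Y m))) = true := by
        rw [← hv]
        simpa [hY] using hYw m
      simp [h, this]
  rw [h₃]
  simp only [← key, COINF, Set.mem_ofPred_eq, Set.Infinite]
  rw [hgW, finite_compl_deficiency_iff, not_exists]
  rfl

/-- For `P` in `Σ⁰₅` given by `R`, the assertion that no `i ≤ x` is an outermost witness for
`e ∈ P` is `Σ⁰₄` in `⟨e, x⟩`. -/
theorem IsSigma5.exists_piPred {P : Set ℕ} (hP : IsSigma5 P) :
    ∃ A, PiPred 3 A ∧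
      ∀ e, (e ∈ P → ∃ x, ∀ x' > x, ¬ ∃ Y, A (Nat.pair (Nat.pair e x') Y)) ∧
        (e ∉ P → ∀ x, ∃ Y, A (Nat.pair (Nat.pair e x) Y)) := by
  obtain ⟨R, hR, hP⟩ := hP
  have hB : PiPred 3 fun t => ∀ z, ¬ ∀ w, ¬ ∀ v,
      ¬ R t.unpair.1 t.unpair.2.unpair.1 t.unpair.2.unpair.2 z w v = true := by
    have hd : Computable fun u : ℕ => u.unpair.1.unpair.1.unpair.1 := computable_unpair_fst.comp
      (computable_unpair_fst.comp computable_unpair_fst)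
    have hx : Computable fun u : ℕ => u.unpair.1.unpair.1.unpair.1.unpair.2.unpair.1 :=
      computable_unpair_fst.comp (computable_unpair_snd.comp hd)
    have hy : Computable fun u : ℕ => u.unpair.1.unpair.1.unpair.1.unpair.2.unpair.2 :=
      computable_unpair_snd.comp (computable_unpair_snd.comp hd)
    have hz : Computable fun u : ℕ => u.unpair.1.unpair.1.unpair.2 :=
      computable_unpair_snd.comp (computable_unpair_fst.comp computable_unpair_fst)
    have hw : Computable fun u : ℕ => u.unpair.1.unpair.2 :=
      computable_unpair_snd.comp computable_unpair_fst
    obtain ⟨r, hr, hrR⟩ : ∃ r : ℕ → Bool, Computable r ∧ ∀ t z w v,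
        r (Nat.pair (Nat.pair (Nat.pair t z) w) v) =
          R t.unpair.1 t.unpair.2.unpair.1 t.unpair.2.unpair.2 z w v :=
      ⟨_, hR.comp ((computable_unpair_fst.comp hd).pair (hx.pair (hy.pair (hz.pair
        (hw.pair computable_unpair_snd))))), fun t z w v => by simp only [Nat.unpair_pair]⟩
    have h₀ : PiPred 0 fun u => r u = true := ⟨r, hr, fun _ => Iff.rfl⟩
    have h₁ : PiPred 1 fun u => ∀ v, ¬ r (Nat.pair u v) = true := ⟨_, h₀, fun _ => Iff.rfl⟩
    have h₂ : PiPred 2 fun u => ∀ w, ¬ ∀ v, ¬ r (Nat.pair (Nat.pair u w) v) = true :=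
      ⟨_, h₁, fun _ => Iff.rfl⟩
    have h₃ : PiPred 3 fun u => ∀ z, ¬ ∀ w, ¬ ∀ v,
        ¬ r (Nat.pair (Nat.pair (Nat.pair u z) w) v) = true := ⟨_, h₂, fun _ => Iff.rfl⟩
    refine h₃.congr fun t => ?_
    simp only [hrR]
  have hfst : Computable fun u : ℕ => u.unpair.1.unpair.1 :=
    computable_unpair_fst.comp computable_unpair_fst
  refine ⟨_, ((hB.comp (g := fun u => Nat.pair u.unpair.1.unpair.1.unpair.1
      (Nat.pair u.unpair.2 (listEntry u.unpair.1.unpair.2 u.unpair.2)))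
    (computable_pair (computable_unpair_fst.comp hfst) (computable_pair computable_unpair_snd
      (computable_listEntry (computable_unpair_snd.comp computable_unpair_fst)
        computable_unpair_snd)))).imp (computable_decide_lt computable_unpair_snd
      (Computable.succ.comp (computable_unpair_snd.comp hfst)))).all, fun e => ⟨?_, ?_⟩⟩
  · intro he
    obtain ⟨x, hx⟩ := (hP e).1 he
    refine ⟨x, ?_⟩
    rintro x' hx' ⟨Y, hY⟩
    have := hY x
    simp only [Nat.unpair_pair, decide_eq_true_eq] at this
    obtain ⟨z, hz⟩ := hx (listEntry Y x)
    exact this (by simp only [Nat.succ_eq_add_one]; omega) z fun w hw =>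
      let ⟨v, hv⟩ := hz w
      hw v hv
  · intro he x
    rw [hP] at he
    push Not at he
    obtain ⟨Y, -, hY⟩ := exists_list_choice (x + 1)
      (fun i y => ∀ z, ∃ w, ∀ v, R e i y z w v ≠ true)
      fun i _ => he i
    refine ⟨Y, fun m => ?_⟩
    simp only [Nat.unpair_pair, decide_eq_true_eq]
    intro hm z hz
    obtain ⟨w, hw⟩ := hY m hm z
    exact hz w hw

/-- For each Σ⁰₅ set `P` there is a computable `f` such that: if `e ∈ P` then
beyond some `x` all `f e x' y` are in COF and below it each `x'` has at most
one `y` with `f e x' y ∈ COINF`; if `e ∉ P` then each `x` has exactly one `y`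
with `f e x y ∈ COINF`. -/
theorem sigma5_coinf_reduction (P : Set ℕ) (hP : IsSigma5 P) :
    ∃ f : ℕ → ℕ → ℕ → ℕ,
      Computable (fun p : ℕ × ℕ × ℕ => f p.1 p.2.1 p.2.2) ∧
      ∀ e, (e ∈ P → ∃ x, (∀ x' > x, ∀ y, f e x' y ∈ COF) ∧
              (∀ x' ≤ x, ∀ y y', f e x' y ∈ COINF → f e x' y' ∈ COINF → y = y')) ∧
           (e ∉ P → ∀ x, ∃! y, f e x y ∈ COINF) := by
  obtain ⟨A, hA, hAP⟩ := hP.exists_piPred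
  obtain ⟨q, hq, hu⟩ := hA.exists_unique_witness
  obtain ⟨g, hg, hgq⟩ := hq.exists_reduction_coinf
  refine ⟨fun e x y => g (Nat.pair (Nat.pair e x) y),
    hg.comp (computable_pair (computable_pair Computable.fst
      (Computable.fst.comp Computable.snd)) (Computable.snd.comp Computable.snd)),
    fun e => ⟨fun he => ?_, fun he x => ?_⟩⟩
  · obtain ⟨x, hx⟩ := (hAP e).1 he
    refine ⟨x, fun x' hx' y => ?_, fun x' _ y y' => ?_⟩
    · by_contra hy
      exact hx x' hx' ((hu _).1.1 ⟨y, (hgq _).2 hy⟩)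
    · simp only [← hgq]
      exact (hu _).2 y y'
  · obtain ⟨y, hy⟩ := (hu _).1.2 ((hAP e).2 he x)
    exact ⟨y, (hgq _).1 hy, fun y' hy' => (hu _).2 _ _ ((hgq _).2 hy') hy⟩
end
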